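/- arXiv:1609.09771 — 7 statements merged into one kernel-verified Lean document; each statement's English description precedes it below -/
import Mathlib

section
/- Let m ≥ 2 and let S be a tempered distribution on ℝ^m (a continuous linear functional on the real Schwartz space of ℝ^m) such that: (a) S is rotation invariant, i.e. S(φ ∘ A) = S(φ) for every linear isometry A of ℝ^m and every Schwartz function φ; (b) S is homogeneous of degree −(m+2), i.e. S(x ↦ φ(a⁻¹ • x)) = a⁻² · S(φ) for every real a > 0 and every Schwartz φ; (c) S(x ↦ ‖x‖² · φ(x)) = m(m+1) · φ(0) for every Schwartz φ. Then S(φ) = ((m+1)/2) · (Δφ)(0) for every Schwartz φ, where Δ denotes the Laplacian. (This expresses the identity ∂_r² δ(x) = ((m+1)/2) Δ δ(x) for the radial second derivative of the delta distribution.) -/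
open MeasureTheory Metric Finset
open scoped SchwartzMap

/-- The Laplacian of a function on `ℝ^m`: the sum of its second partial derivatives. -/
noncomputable def laplacian {m : ℕ} (φ : EuclideanSpace ℝ (Fin m) → ℝ)
    (x : EuclideanSpace ℝ (Fin m)) : ℝ :=
  ∑ j : Fin m, fderiv ℝ (fun y => fderiv ℝ φ y (EuclideanSpace.single j 1)) x
    (EuclideanSpace.single j 1)

open scoped ContDiff Topology
open Filter

/-- A radial smooth cutoff `η`, equal to `1` near the origin, such that `(1 - η) / ‖x‖²` has
temperate growth. -/
theorem exists_radial_cutoff (E : Type*) [NormedAddCommGroup E] [InnerProductSpace ℝ E]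
    [FiniteDimensional ℝ E] :
    ∃ (η : 𝓢(E, ℝ)) (v : E → ℝ), v.HasTemperateGrowth ∧ (∀ x, ‖x‖ ^ 2 * v x = 1 - η x) ∧
      (∀ᶠ x in 𝓝 0, η x = 1) ∧ ∀ x y, ‖x‖ = ‖y‖ → η x = η y := by
  let β : ContDiffBump (1 : ℝ) := ⟨1 / 4, 1 / 2, by norm_num, by norm_num⟩
  let γ : ContDiffBump (0 : ℝ) := ⟨2, 3, by norm_num, by norm_num⟩
  let u : E → ℝ := fun x => (1 + ‖x‖ ^ 2) ^ (-1 : ℝ)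
  have hu : u.HasTemperateGrowth := Function.hasTemperateGrowth_one_add_norm_sq_rpow E (-1)
  have hu' : ∀ x, u x = (1 + ‖x‖ ^ 2)⁻¹ := fun x => Real.rpow_neg_one _
  let k : ℝ → ℝ := fun t => γ t * ((1 - β t) * t / (1 - t))
  have hk : ContDiff ℝ ∞ k := by
    rw [contDiff_iff_contDiffAt]
    intro t
    by_cases ht : t = 1
    · subst ht
      refine (contDiffAt_const (c := (0 : ℝ))).congr_of_eventuallyEq ?_
      filter_upwards [β.eventuallyEq_one] with t ht
      simp [k, ht]
    · have h1 : 1 - t ≠ 0 := sub_ne_zero.2 (Ne.symm ht)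
      exact γ.contDiffAt.mul (((contDiffAt_const.sub β.contDiffAt).mul contDiffAt_id).div
        (contDiffAt_const.sub contDiffAt_id) h1)
  have hkc : HasCompactSupport k := γ.hasCompactSupport.mul_right
  have hηc : HasCompactSupport (fun x => β (u x)) := by
    refine HasCompactSupport.intro (isCompact_closedBall (0 : E) 1) fun x hx => ?_
    refine β.zero_of_le_dist ?_
    have h1 : 1 < ‖x‖ := by simpa using hx
    have h2 : u x ≤ 1 / 2 := by
      rw [hu', one_div]
      exact inv_anti₀ (by norm_num) (by nlinarith)
    change (1 / 2 : ℝ) ≤ _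
    rw [Real.dist_eq, abs_sub_comm]
    exact le_trans (by linarith) (le_abs_self _)
  refine ⟨hηc.toSchwartzMap (β.contDiff.comp hu.1), k ∘ u,
    (hkc.hasTemperateGrowth hk).comp hu, fun x => ?_, ?_, fun x y h => ?_⟩
  · have h1 : γ (u x) = 1 := by
      refine γ.one_of_mem_closedBall ?_
      have : u x ≤ 1 := by rw [hu']; exact inv_le_one_of_one_le₀ (by nlinarith [sq_nonneg ‖x‖])
      have : 0 ≤ u x := by rw [hu']; positivity
      change _ ∈ closedBall (0 : ℝ) 2
      rw [mem_closedBall, Real.dist_eq, sub_zero, abs_of_nonneg this]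
      linarith
    change ‖x‖ ^ 2 * (γ (u x) * ((1 - β (u x)) * u x / (1 - u x))) = 1 - β (u x)
    rw [h1]
    rcases eq_or_ne x 0 with rfl | hx
    · have : u 0 = 1 := by simp [hu']
      rw [this, β.one_of_mem_closedBall (mem_closedBall_self β.rIn_pos.le)]
      simp
    · have h2 : 0 < ‖x‖ := norm_pos_iff.2 hx
      have h3 : 1 - (1 + ‖x‖ ^ 2)⁻¹ = ‖x‖ ^ 2 * (1 + ‖x‖ ^ 2)⁻¹ := by field_simp; ring
      rw [hu' x, h3]
      field_simp
  · have h0 : u 0 = 1 := by simp [hu']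
    have : Tendsto u (𝓝 0) (𝓝 1) := h0 ▸ hu.1.continuous.tendsto 0
    exact this.eventually β.eventuallyEq_one
  · change β (u x) = β (u y)
    rw [hu', hu', h]

variable {E : Type*} [NormedAddCommGroup E] [NormedSpace ℝ E]

theorem SchwartzMap.norm_iteratedFDeriv_le_pow (φ : 𝓢(E, ℝ)) (N : ℕ)
    (h0 : ∀ j < N, iteratedFDeriv ℝ j φ 0 = 0) (j : ℕ) :
    ∃ M, 0 ≤ M ∧ ∀ x, ‖iteratedFDeriv ℝ j φ x‖ ≤ M * ‖x‖ ^ (N - j) := by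
  induction hd : N - j generalizing j with
  | zero =>
    exact ⟨_, apply_nonneg _ _, fun x => by
      simpa using φ.norm_iteratedFDeriv_le_seminorm ℝ j x⟩
  | succ d ih =>
    obtain ⟨M, hM, h⟩ := ih (j + 1) (by omega)
    refine ⟨M, hM, fun x => ?_⟩
    have key := (convex_closedBall (0 : E) ‖x‖).norm_image_sub_le_of_norm_fderiv_le
      (𝕜 := ℝ) (f := iteratedFDeriv ℝ j φ) (C := M * ‖x‖ ^ d) (x := 0) (y := x)
      (fun y _ => ((φ.smooth ⊤).differentiable_iteratedFDeriv
        (by exact_mod_cast ENat.natCast_lt_top j)) y)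
      (fun y hy => by
        rw [norm_fderiv_iteratedFDeriv]
        refine (h y).trans ?_
        have : ‖y‖ ≤ ‖x‖ := by simpa using hy
        gcongr)
      (by simp) (by simp)
    rw [h0 j (by omega), sub_zero, sub_zero] at key
    rwa [pow_succ, ← mul_assoc]

/-- If `φ` vanishes to order `N` at the origin, then the seminorms of `η φ(b •)` are `O(b ^ N)`. -/
theorem SchwartzMap.seminorm_mul_comp_smul_le (φ η : 𝓢(E, ℝ)) (N : ℕ)
    (h0 : ∀ j < N, iteratedFDeriv ℝ j φ 0 = 0) (k n : ℕ) :
    ∃ C, 0 ≤ C ∧ ∀ b : ℝ, 0 < b → b ≤ 1 → ∀ χ : 𝓢(E, ℝ), (∀ x, χ x = η x * φ (b • x)) →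
      SchwartzMap.seminorm ℝ k n χ ≤ C * b ^ N := by
  choose M hM hφ using φ.norm_iteratedFDeriv_le_pow N h0
  let D : ℕ → ℝ := fun i => 2 ^ (k + N) *
    (Finset.Iic (k + N, i)).sup (fun m => SchwartzMap.seminorm ℝ m.1 m.2) η
  have hD0 : ∀ i, 0 ≤ D i := fun i => mul_nonneg (by positivity) (apply_nonneg _ _)
  have hD : ∀ i x, (1 + ‖x‖) ^ (k + N) * ‖iteratedFDeriv ℝ i η x‖ ≤ D i := fun i x =>
    SchwartzMap.one_add_le_sup_seminorm_apply (𝕜 := ℝ) (m := (k + N, i)) le_rfl le_rfl η x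
  have hC : 0 ≤ ∑ i ∈ Finset.range (n + 1), (n.choose i : ℝ) * D i * M (n - i) :=
    Finset.sum_nonneg fun i _ => mul_nonneg (mul_nonneg (by positivity) (hD0 i)) (hM _)
  refine ⟨_, hC, fun b hb hb1 χ hχ => ?_⟩
  refine SchwartzMap.seminorm_le_bound ℝ k n χ (mul_nonneg hC (by positivity)) fun x => ?_
  have hs : ContDiff ℝ n (fun x => φ (b • x)) := (φ.smooth n).comp (contDiff_const_smul b)
  have h1 := norm_iteratedFDeriv_mul_le (η.smooth n) hs x (n := n) le_rfl
  rw [show (χ : E → ℝ) = fun x => η x * φ (b • x) from funext hχ]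
  refine (mul_le_mul_of_nonneg_left h1 (by positivity)).trans ?_
  rw [Finset.mul_sum, Finset.sum_mul]
  refine Finset.sum_le_sum fun i _ => ?_
  have hb' : ‖iteratedFDeriv ℝ (n - i) (fun x => φ (b • x)) x‖ ≤
      M (n - i) * (b ^ N * (1 + ‖x‖) ^ N) := by
    rw [iteratedFDeriv_comp_const_smul b (φ.smooth (n - i : ℕ)), norm_smul, norm_pow,
      Real.norm_of_nonneg hb.le]
    calc b ^ (n - i) * ‖iteratedFDeriv ℝ (n - i) φ (b • x)‖
        ≤ b ^ (n - i) * (M (n - i) * ‖b • x‖ ^ (N - (n - i))) := by gcongr; exact hφ _ _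
      _ = M (n - i) * (b ^ ((n - i) + (N - (n - i))) * ‖x‖ ^ (N - (n - i))) := by
        rw [norm_smul, Real.norm_of_nonneg hb.le]; ring
      _ ≤ M (n - i) * (b ^ N * (1 + ‖x‖) ^ N) := by
        refine mul_le_mul_of_nonneg_left (mul_le_mul
          (pow_le_pow_of_le_one hb.le hb1 (by omega)) ?_ (by positivity) (by positivity)) (hM _)
        calc ‖x‖ ^ (N - (n - i)) ≤ (1 + ‖x‖) ^ (N - (n - i)) := by gcongr; linarith
          _ ≤ (1 + ‖x‖) ^ N :=
            pow_le_pow_right₀ (by linarith [norm_nonneg x]) (Nat.sub_le _ _)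
  have hx : ‖x‖ ^ k * (1 + ‖x‖) ^ N * ‖iteratedFDeriv ℝ i η x‖ ≤ D i := by
    refine le_trans ?_ (hD i x)
    rw [pow_add]
    gcongr
    linarith
  calc ‖x‖ ^ k * ((n.choose i : ℝ) * ‖iteratedFDeriv ℝ i η x‖ *
        ‖iteratedFDeriv ℝ (n - i) (fun x => φ (b • x)) x‖)
      ≤ ‖x‖ ^ k * ((n.choose i : ℝ) * ‖iteratedFDeriv ℝ i η x‖ *
        (M (n - i) * (b ^ N * (1 + ‖x‖) ^ N))) := by gcongr
    _ = (‖x‖ ^ k * (1 + ‖x‖) ^ N * ‖iteratedFDeriv ℝ i η x‖) *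
        ((n.choose i : ℝ) * M (n - i) * b ^ N) := by ring
    _ ≤ D i * ((n.choose i : ℝ) * M (n - i) * b ^ N) :=
      mul_le_mul_of_nonneg_right hx (mul_nonneg (mul_nonneg (by positivity) (hM _)) (by positivity))
    _ = (n.choose i : ℝ) * D i * M (n - i) * b ^ N := by ring

/-- Precomposition with the dilation by a positive factor. -/
theorem SchwartzMap.exists_comp_smul (φ : 𝓢(E, ℝ)) {b : ℝ} (hb : 0 < b) :
    ∃ ψ : 𝓢(E, ℝ), ∀ x, ψ x = φ (b • x) :=
  ⟨SchwartzMap.compCLMOfContinuousLinearEquiv ℝ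
    (ContinuousLinearEquiv.smulLeft (Units.mk0 b hb.ne')) φ, fun _ => rfl⟩

/-- A tempered distribution that is homogeneous like a second derivative of `δ` and whose product
with `‖x‖²` is a multiple of `δ` kills every function vanishing to third order at the origin. -/
theorem apply_eq_zero_of_iteratedFDeriv_eq_zero {E : Type*} [NormedAddCommGroup E]
    [InnerProductSpace ℝ E] [FiniteDimensional ℝ E] (S : 𝓢(E, ℝ) →L[ℝ] ℝ) (c : ℝ)
    (hhom : ∀ a : ℝ, 0 < a → ∀ φ ψ : 𝓢(E, ℝ), (∀ x, ψ x = φ (a⁻¹ • x)) → S ψ = (a ^ 2)⁻¹ * S φ)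
    (hmul : ∀ φ ψ : 𝓢(E, ℝ), (∀ x, ψ x = ‖x‖ ^ 2 * φ x) → S ψ = c * φ 0)
    (φ : 𝓢(E, ℝ)) (h0 : ∀ j < 3, iteratedFDeriv ℝ j φ 0 = 0) : S φ = 0 := by
  obtain ⟨η, v, hv, hvη, -, -⟩ := exists_radial_cutoff E
  have hφ0 : φ 0 = 0 := by
    have := norm_iteratedFDeriv_zero (𝕜 := ℝ) (f := φ) (x := 0)
    rwa [h0 0 (by norm_num), norm_zero, eq_comm, norm_eq_zero] at this
  have hex : ∀ n : ℕ, ∃ χ : 𝓢(E, ℝ), (∀ x, χ x = η x * φ ((1 / ((n : ℝ) + 1)) • x)) ∧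
      S χ = (1 / ((n : ℝ) + 1)) ^ 2 * S φ := by
    intro n
    have hb : 0 < 1 / ((n : ℝ) + 1) := by positivity
    obtain ⟨ψ, hψ⟩ := φ.exists_comp_smul hb
    refine ⟨SchwartzMap.smulLeftCLM ℝ η ψ, fun x => ?_, ?_⟩
    · rw [SchwartzMap.smulLeftCLM_apply_apply η.hasTemperateGrowth, hψ, smul_eq_mul]
    · have h1 : S ψ = (1 / ((n : ℝ) + 1)) ^ 2 * S φ := by
        rw [hhom _ (inv_pos.2 hb) φ ψ (by simpa using hψ)]
        simp
      have h2 := hmul (SchwartzMap.smulLeftCLM ℝ v ψ) (ψ - SchwartzMap.smulLeftCLM ℝ η ψ)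
        fun x => by
          rw [sub_apply, SchwartzMap.smulLeftCLM_apply_apply η.hasTemperateGrowth,
            SchwartzMap.smulLeftCLM_apply_apply hv, smul_eq_mul, smul_eq_mul, ← mul_assoc, hvη]
          ring
      rw [SchwartzMap.smulLeftCLM_apply_apply hv, hψ, smul_zero, hφ0, smul_zero, mul_zero,
        map_sub, sub_eq_zero] at h2
      rw [← h2, h1]
  choose χ hχ hSχ using hex
  have hlim : Tendsto (fun n : ℕ => ((1 / ((n : ℝ) + 1)) ^ 2)⁻¹ • χ n) atTop (𝓝 0) := by
    rw [(schwartz_withSeminorms ℝ E ℝ).tendsto_nhds]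
    rintro ⟨k, n⟩ ε hε
    obtain ⟨C, -, h⟩ := φ.seminorm_mul_comp_smul_le η 3 h0 k n
    have ht : Tendsto (fun n : ℕ => C * (1 / ((n : ℝ) + 1))) atTop (𝓝 0) := by
      simpa using tendsto_one_div_add_atTop_nhds_zero_nat.const_mul C
    filter_upwards [ht.eventually_lt_const hε] with i hi
    have hb : 0 < 1 / ((i : ℝ) + 1) := by positivity
    have hb1 : 1 / ((i : ℝ) + 1) ≤ 1 := by
      rw [div_le_one (by positivity)]
      linarith [i.cast_nonneg (α := ℝ)]
    have h3 := h _ hb hb1 (χ i) (hχ i)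
    rw [sub_zero, map_smul_eq_mul, SchwartzMap.schwartzSeminormFamily_apply,
      Real.norm_of_nonneg (by positivity)]
    refine lt_of_le_of_lt ?_ hi
    rw [inv_mul_le_iff₀ (by positivity)]
    exact h3.trans_eq (by ring)
  have h4 : Tendsto (fun n : ℕ => S (((1 / ((n : ℝ) + 1)) ^ 2)⁻¹ • χ n)) atTop (𝓝 0) := by
    simpa only [map_zero, Function.comp_def] using (S.continuous.tendsto 0).comp hlim
  have h5 : ∀ n : ℕ, S (((1 / ((n : ℝ) + 1)) ^ 2)⁻¹ • χ n) = S φ := fun n => by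
    rw [map_smul, hSχ, smul_eq_mul, inv_mul_cancel_left₀ (by positivity)]
  simp only [h5] at h4
  exact tendsto_nhds_unique tendsto_const_nhds h4

theorem iteratedFDeriv_eq_zero_of_fderiv_eq_zero {f : E → ℝ} {x : E} (h0 : f x = 0)
    (h1 : fderiv ℝ f x = 0) (h2 : fderiv ℝ (fderiv ℝ f) x = 0) :
    ∀ j < 3, iteratedFDeriv ℝ j f x = 0 := by
  intro j hj
  ext v
  interval_cases j
  · simp [h0]
  · simp [iteratedFDeriv_one_apply, h1]
  · simp [iteratedFDeriv_two_apply, h2]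

/-- Two functions, the second of which agrees near `0` with the second Taylor polynomial of the
first, have the same 2-jet at `0`. -/
theorem iteratedFDeriv_sub_eq_zero_of_eventuallyEq {f g : E → ℝ} (hf : ContDiff ℝ 2 f)
    (hg : ∀ᶠ x in 𝓝 0, g x =
      f 0 + fderiv ℝ f 0 x + (1 / 2) * fderiv ℝ (fderiv ℝ f) 0 x x) :
    ∀ j < 3, iteratedFDeriv ℝ j (fun x => f x - g x) 0 = 0 := by
  set ℓ := fderiv ℝ f 0 with hℓ
  set B := fderiv ℝ (fderiv ℝ f) 0 with hB
  have hsymm : B.flip = B := by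
    ext v w
    exact (hf.contDiffAt.isSymmSndFDerivAt (by simp [minSmoothness_of_isRCLikeNormedField])) w v
  have hf1 : Differentiable ℝ f := hf.differentiable (by simp)
  have hf2 : Differentiable ℝ (fderiv ℝ f) :=
    (hf.fderiv_right (m := 1) (by norm_num)).differentiable (by simp)
  have hd : ∀ x, HasFDerivAt (fun x => f x - (f 0 + ℓ x + (1 / 2) * B x x))
      (fderiv ℝ f x - (ℓ + B x)) x := by
    intro x
    have hq : HasFDerivAt (fun x => B x x) (B x + B x) x := by
      have := B.hasFDerivAt (x := x) |>.clm_apply (hasFDerivAt_id x)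
      refine this.congr_fderiv ?_
      ext v
      have := congrArg (fun L => L x v) hsymm
      simp at this
      simp [this]
    refine (hf1 x).hasFDerivAt.sub
      ((((ℓ.hasFDerivAt).const_add (f 0)).add (hq.const_mul (1 / 2))).congr_fderiv ?_)
    ext v
    simp
    ring
  have hd' : fderiv ℝ (fun x => f x - (f 0 + ℓ x + (1 / 2) * B x x)) =
      fun x => fderiv ℝ f x - (ℓ + B x) := funext fun x => (hd x).fderiv
  have hd2 : fderiv ℝ (fun x => fderiv ℝ f x - (ℓ + B x)) 0 = 0 := by
    have := (hf2 0).hasFDerivAt.sub ((B.hasFDerivAt (x := 0)).const_add ℓ)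
    exact this.fderiv.trans (sub_self B)
  have heq : (fun x => f x - g x) =ᶠ[𝓝 0] fun x => f x - (f 0 + ℓ x + (1 / 2) * B x x) := by
    filter_upwards [hg] with x hx
    rw [hx]
  apply iteratedFDeriv_eq_zero_of_fderiv_eq_zero
  · rw [heq.eq_of_nhds]
    simp
  · rw [heq.fderiv_eq, hd']
    simp [hℓ]
  · rw [heq.fderiv.fderiv_eq, hd', hd2]

theorem laplacian_eq_sum_fderiv_fderiv {m : ℕ} {f : EuclideanSpace ℝ (Fin m) → ℝ}
    (hf : ContDiff ℝ 2 f) (x : EuclideanSpace ℝ (Fin m)) :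
    laplacian f x = ∑ j, fderiv ℝ (fderiv ℝ f) x (EuclideanSpace.single j 1)
      (EuclideanSpace.single j 1) := by
  have hf2 : Differentiable ℝ (fderiv ℝ f) :=
    (hf.fderiv_right (m := 1) (by norm_num)).differentiable (by simp)
  refine Finset.sum_congr rfl fun j _ => ?_
  rw [((hf2 x).hasFDerivAt.clm_apply (hasFDerivAt_const _ x)).fderiv]
  simp

theorem EuclideanSpace.sum_smul_single {m : ℕ} (x : EuclideanSpace ℝ (Fin m)) :
    ∑ i, x i • (EuclideanSpace.single i 1 : EuclideanSpace ℝ (Fin m)) = x := by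
  ext j
  simp [Pi.single_apply]

/-- A rotation invariant tempered distribution `S` with `‖x‖² S = m c δ` takes the value `c` on
`x i * x i` and `0` on `x i * x j`, `i ≠ j`, times a radial cutoff. -/
theorem apply_monomial_mul_cutoff {m : ℕ} (hm : 2 ≤ m) {c : ℝ}
    (S : 𝓢(EuclideanSpace ℝ (Fin m), ℝ) →L[ℝ] ℝ)
    (hrot : ∀ (A : EuclideanSpace ℝ (Fin m) ≃ₗᵢ[ℝ] EuclideanSpace ℝ (Fin m))
      (φ ψ : 𝓢(EuclideanSpace ℝ (Fin m), ℝ)), (∀ x, ψ x = φ (A x)) → S ψ = S φ)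
    (hmul : ∀ φ ψ : 𝓢(EuclideanSpace ℝ (Fin m), ℝ),
      (∀ x, ψ x = ‖x‖ ^ 2 * φ x) → S ψ = (m : ℝ) * c * φ 0)
    (η : 𝓢(EuclideanSpace ℝ (Fin m), ℝ)) (hη0 : η 0 = 1)
    (hη : ∀ x y, ‖x‖ = ‖y‖ → η x = η y)
    (Q : Fin m → Fin m → 𝓢(EuclideanSpace ℝ (Fin m), ℝ))
    (hQ : ∀ i j x, Q i j x = x i * x j * η x) (i j : Fin m) :
    S (Q i j) = if i = j then c else 0 := by
  split_ifs with hij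
  · subst hij
    have hall : ∀ j, S (Q j j) = S (Q i i) := by
      intro j
      refine hrot (LinearIsometryEquiv.piLpCongrLeft 2 ℝ ℝ (Equiv.swap i j)) _ _ fun x => ?_
      rw [hQ, hQ, hη _ x (LinearIsometryEquiv.norm_map _ x)]
      simp [LinearIsometryEquiv.piLpCongrLeft_apply, Equiv.piCongrLeft']
    have hsum := hmul η (∑ j, Q j j) fun x => by
      rw [EuclideanSpace.real_norm_sq_eq, Finset.sum_mul, _root_.sum_apply]
      exact Finset.sum_congr rfl fun j _ => by rw [hQ, pow_two]
    rw [map_sum, Finset.sum_congr rfl fun j _ => hall j, hη0] at hsum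
    have hm0 : (m : ℝ) ≠ 0 := by positivity
    simpa [hm0] using hsum
  · have := hrot (LinearIsometryEquiv.piLpCongrRight 2 fun k =>
      if k = i then LinearIsometryEquiv.neg ℝ else LinearIsometryEquiv.refl ℝ ℝ)
      (Q i j) (-(Q i j)) fun x => by
        rw [neg_apply, hQ, hQ, hη _ x (LinearIsometryEquiv.norm_map _ x)]
        simp [Ne.symm hij]
    rw [map_neg] at this
    linarith

/-- ∂_r² δ(x) = ((m+1)/2) Δ δ(x): any rotation-invariant tempered distribution,
homogeneous of degree −(m+2), with r²·S = m(m+1) δ, equals ((m+1)/2) Δδ. -/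
theorem radial_second_derivative_of_delta (m : ℕ) (hm : 2 ≤ m)
    (S : 𝓢(EuclideanSpace ℝ (Fin m), ℝ) →L[ℝ] ℝ)
    (hrot : ∀ (A : EuclideanSpace ℝ (Fin m) ≃ₗᵢ[ℝ] EuclideanSpace ℝ (Fin m))
      (φ ψ : 𝓢(EuclideanSpace ℝ (Fin m), ℝ)), (∀ x, ψ x = φ (A x)) → S ψ = S φ)
    (hhom : ∀ a : ℝ, 0 < a → ∀ φ ψ : 𝓢(EuclideanSpace ℝ (Fin m), ℝ),
      (∀ x, ψ x = φ (a⁻¹ • x)) → S ψ = (a ^ 2)⁻¹ * S φ)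
    (hmul : ∀ φ ψ : 𝓢(EuclideanSpace ℝ (Fin m), ℝ),
      (∀ x, ψ x = ‖x‖ ^ 2 * φ x) → S ψ = (m : ℝ) * ((m : ℝ) + 1) * φ 0) :
    ∀ φ : 𝓢(EuclideanSpace ℝ (Fin m), ℝ),
      S φ = (((m : ℝ) + 1) / 2) * laplacian (⇑φ) 0 := by
  intro φ
  obtain ⟨η, -, -, -, hη1, hη⟩ := exists_radial_cutoff (EuclideanSpace ℝ (Fin m))
  have hjet := apply_eq_zero_of_iteratedFDeriv_eq_zero S _ hhom hmul
  have hη0 : η 0 = 1 := hη1.self_of_nhds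
  have hx : ∀ i : Fin m, (fun x : EuclideanSpace ℝ (Fin m) => x i).HasTemperateGrowth :=
    fun i => (EuclideanSpace.proj i : EuclideanSpace ℝ (Fin m) →L[ℝ] ℝ).hasTemperateGrowth
  let X : Fin m → 𝓢(EuclideanSpace ℝ (Fin m), ℝ) :=
    fun i => SchwartzMap.smulLeftCLM ℝ (fun x => x i) η
  let Q : Fin m → Fin m → 𝓢(EuclideanSpace ℝ (Fin m), ℝ) :=
    fun i j => SchwartzMap.smulLeftCLM ℝ (fun x => x i) (X j)
  have hX : ∀ i x, X i x = x i * η x := fun i x =>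
    SchwartzMap.smulLeftCLM_apply_apply (hx i) η x
  have hQ : ∀ i j x, Q i j x = x i * x j * η x := fun i j x => by
    rw [SchwartzMap.smulLeftCLM_apply_apply (hx i), hX, smul_eq_mul, mul_assoc]
  have hSη : S η = 0 := by
    obtain ⟨ψ, hψ⟩ := η.exists_comp_smul (b := 2) two_pos
    have h1 := hhom (1 / 2) (by norm_num) η ψ (by simpa using hψ)
    have h2 : S (ψ - η) = 0 := by
      have ht : Tendsto (fun x : EuclideanSpace ℝ (Fin m) => (2 : ℝ) • x) (𝓝 0) (𝓝 0) := by
        simpa using (continuous_const_smul (2 : ℝ)).tendsto (0 : EuclideanSpace ℝ (Fin m))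
      have h0 : (ψ - η : 𝓢(EuclideanSpace ℝ (Fin m), ℝ)) =ᶠ[𝓝 0] fun _ => (0 : ℝ) := by
        filter_upwards [hη1, ht.eventually hη1] with x h3 h4
        simp [hψ, h3, h4]
      exact hjet _ fun j _ => by simpa using h0.iteratedFDeriv ℝ j |>.eq_of_nhds
    rw [map_sub, h1] at h2
    linarith
  have hSX : ∀ i, S (X i) = 0 := fun i => by
    have := hrot (LinearIsometryEquiv.neg ℝ) (X i) (-(X i)) fun x => by
      rw [neg_apply, hX, hX, hη _ x (LinearIsometryEquiv.norm_map _ x)]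
      simp
    rw [map_neg] at this
    linarith
  have hSQ := apply_monomial_mul_cutoff hm S hrot hmul η hη0 hη Q hQ
  set e : Fin m → EuclideanSpace ℝ (Fin m) := fun i => EuclideanSpace.single i 1 with he
  set ℓ := fderiv ℝ φ 0
  set B := fderiv ℝ (fderiv ℝ φ) 0 with hB
  let T : 𝓢(EuclideanSpace ℝ (Fin m), ℝ) :=
    φ 0 • η + ∑ i, ℓ (e i) • X i + (1 / 2 : ℝ) • ∑ i, ∑ j, B (e i) (e j) • Q i j
  have hT : ∀ᶠ x in 𝓝 0, T x = φ 0 + ℓ x + (1 / 2) * B x x := by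
    filter_upwards [hη1] with x h1
    have hℓx : ℓ x = ∑ i, ℓ (e i) * x i := by
      conv_lhs => rw [← EuclideanSpace.sum_smul_single x]
      simp [he, mul_comm]
    have hBx : B x x = ∑ i, ∑ j, B (e i) (e j) * (x i * x j) := by
      conv_lhs => rw [← EuclideanSpace.sum_smul_single x]
      simp only [map_sum, map_smul, _root_.sum_apply, smul_apply,
        smul_eq_mul, Finset.mul_sum]
      rw [Finset.sum_comm]
      exact Finset.sum_congr rfl fun i _ => Finset.sum_congr rfl fun j _ => by ring
    simp [T, hX, hQ, h1, hℓx, hBx]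
  have hST : S (φ - T) = 0 :=
    hjet _ (iteratedFDeriv_sub_eq_zero_of_eventuallyEq (φ.smooth 2) hT)
  rw [map_sub, sub_eq_zero] at hST
  rw [hST, laplacian_eq_sum_fderiv_fderiv (φ.smooth 2), ← hB]
  simp [T, hSη, hSX, hSQ, ← Finset.sum_mul, he]
  ring
end

section
/- Let m ≥ 2 and let S be a tempered distribution on ℝ^m such that: (a) S(φ ∘ A) = S(φ) for every linear isometry A of ℝ^m and every Schwartz function φ; (b) S(x ↦ φ(a⁻¹ • x)) = a⁻² · S(φ) for every real a > 0 and every Schwartz φ; (c) S(x ↦ ‖x‖² · φ(x)) = −m · φ(0) for every Schwartz φ. Then S(φ) = −(1/2) · (Δφ)(0) for every Schwartz φ. (This expresses the identity (r⁻¹ ∂_r) δ(x) = −(1/2) Δ δ(x).) -/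
open MeasureTheory Metric Finset
open scoped SchwartzMap

open scoped ContDiff Topology

section Flatness

variable {E F : Type} [NormedAddCommGroup E] [NormedSpace ℝ E]
  [NormedAddCommGroup F] [NormedSpace ℝ F]

/-- `f` is smooth, vanishes to order `k` at the origin, and all its derivatives are controlled
globally by the corresponding powers of the norm. -/
def FlatOfOrder (k : ℕ) (f : E → F) : Prop :=
  ContDiff ℝ ∞ f ∧ ∀ n : ℕ, ∃ C : ℝ, 0 ≤ C ∧ ∀ y, ‖iteratedFDeriv ℝ n f y‖ ≤ C * ‖y‖ ^ (k - n)

lemma FlatOfOrder.sub_const {f : E → F} (hf : FlatOfOrder 0 f) (c : F) :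
    FlatOfOrder 0 (fun x => f x - c) := by
  refine ⟨hf.1.sub contDiff_const, fun n => ?_⟩
  obtain ⟨C, hC, h⟩ := hf.2 n
  obtain ⟨D, hD, h'⟩ : ∃ D : ℝ, 0 ≤ D ∧ ∀ y, ‖iteratedFDeriv ℝ n (fun _ : E => c) y‖ ≤ D := by
    rcases eq_or_ne n 0 with rfl | hn
    · exact ⟨‖c‖, norm_nonneg _, fun y => by simp⟩
    · exact ⟨0, le_rfl, fun y => by simp [iteratedFDeriv_const_of_ne hn]⟩
  refine ⟨C + D, by positivity, fun y => ?_⟩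
  have hn : (n : ℕ∞ω) ≤ ∞ := mod_cast le_top
  have : iteratedFDeriv ℝ n (fun x => f x - c) y =
      iteratedFDeriv ℝ n f y - iteratedFDeriv ℝ n (fun _ : E => c) y :=
    iteratedFDeriv_sub_apply (hf.1.of_le hn).contDiffAt contDiff_const.contDiffAt
  rw [this]
  have h1 := h y
  simp only [Nat.zero_sub, pow_zero, mul_one] at h1 ⊢
  exact (norm_sub_le _ _).trans (add_le_add h1 (h' y))

lemma FlatOfOrder.fderiv {f : E → F} (hf : FlatOfOrder 0 f) : FlatOfOrder 0 (fderiv ℝ f) := by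
  refine ⟨hf.1.fderiv_right (by simp), fun n => ?_⟩
  obtain ⟨C, hC, h⟩ := hf.2 (n + 1)
  exact ⟨C, hC, fun y => by simpa [norm_iteratedFDeriv_fderiv] using h y⟩

lemma FlatOfOrder.of_fderiv {k : ℕ} {f : E → F} (hf : ContDiff ℝ ∞ f) (h0 : f 0 = 0)
    (h : FlatOfOrder k (_root_.fderiv ℝ f)) : FlatOfOrder (k + 1) f := by
  refine ⟨hf, fun n => ?_⟩
  cases n with
  | succ n =>
    obtain ⟨C, hC, h⟩ := h.2 n
    refine ⟨C, hC, fun y => ?_⟩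
    rw [← norm_iteratedFDeriv_fderiv, Nat.add_sub_add_right]
    exact h y
  | zero =>
    obtain ⟨C, hC, h⟩ := h.2 0
    refine ⟨C, hC, fun y => ?_⟩
    have key := (convex_closedBall (0 : E) ‖y‖).norm_image_sub_le_of_norm_fderiv_le (𝕜 := ℝ)
      (f := f) (C := C * ‖y‖ ^ k) (x := 0) (y := y)
      (fun x _ => (hf.differentiable (by simp)).differentiableAt) (fun x hx => by
        have := h x
        simp only [norm_iteratedFDeriv_zero, Nat.sub_zero] at this
        refine this.trans ?_
        have : ‖x‖ ≤ ‖y‖ := by simpa using hx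
        gcongr) (by simp) (by simp)
    rw [norm_iteratedFDeriv_zero, Nat.sub_zero, pow_succ, ← mul_assoc]
    simpa [h0] using key

lemma SchwartzMap.flatOfOrder_zero (φ : 𝓢(E, F)) : FlatOfOrder 0 φ := by
  refine ⟨φ.smooth ⊤, fun n => ?_⟩
  obtain ⟨C, hC, h⟩ := φ.decay 0 n
  exact ⟨C, hC.le, fun y => by simpa using h y⟩

lemma FlatOfOrder.norm_iteratedFDeriv_comp_smul_le {k : ℕ} {f : E → F} (hf : FlatOfOrder k f)
    (n : ℕ) : ∃ C : ℝ, 0 ≤ C ∧ ∀ t : ℝ, 0 < t → t ≤ 1 → ∀ x,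
      ‖iteratedFDeriv ℝ n (fun x => f (t • x)) x‖ ≤ C * t ^ k * (1 + ‖x‖) ^ k := by
  obtain ⟨C, hC, h⟩ := hf.2 n
  refine ⟨C, hC, fun t ht ht1 x => ?_⟩
  have hn : (n : ℕ∞ω) ≤ ∞ := mod_cast le_top
  rw [iteratedFDeriv_comp_const_smul t (hf.1.of_le hn), norm_smul, norm_pow,
    Real.norm_of_nonneg ht.le]
  have h1 := h (t • x)
  rw [norm_smul, Real.norm_of_nonneg ht.le, mul_pow] at h1
  have hx : ‖x‖ ^ (k - n) ≤ (1 + ‖x‖) ^ k :=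
    (pow_le_pow_left₀ (norm_nonneg _) (by linarith) _).trans
      (pow_le_pow_right₀ (by linarith [norm_nonneg x]) (Nat.sub_le _ _))
  have ht' : t ^ n * t ^ (k - n) ≤ t ^ k := by
    rw [← pow_add]
    exact pow_le_pow_of_le_one ht.le ht1 (by omega)
  calc t ^ n * ‖iteratedFDeriv ℝ n f (t • x)‖
      ≤ t ^ n * (C * (t ^ (k - n) * ‖x‖ ^ (k - n))) := by gcongr
    _ = C * (t ^ n * t ^ (k - n)) * ‖x‖ ^ (k - n) := by ring
    _ ≤ C * t ^ k * (1 + ‖x‖) ^ k := by gcongr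

/-- Pairing a tempered distribution with `ψ · f(t ·)` is `O(t ^ k)` when `f` is flat of
order `k`. -/
lemma FlatOfOrder.exists_abs_le {k : ℕ} {f : E → ℝ} (hf : FlatOfOrder k f)
    (S : 𝓢(E, ℝ) →L[ℝ] ℝ) (ψ : 𝓢(E, ℝ)) :
    ∃ C : ℝ, 0 ≤ C ∧ ∀ t : ℝ, 0 < t → t ≤ 1 → ∀ η : 𝓢(E, ℝ),
      (∀ x, η x = ψ x * f (t • x)) → |S η| ≤ C * t ^ k := by
  obtain ⟨s, D, -, hD⟩ := Seminorm.bound_of_continuous (schwartz_withSeminorms ℝ E ℝ)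
    ((normSeminorm ℝ ℝ).comp S.toLinearMap) (continuous_norm.comp S.continuous)
  have key : ∀ i : ℕ × ℕ, ∃ M : ℝ, 0 ≤ M ∧ ∀ t : ℝ, 0 < t → t ≤ 1 → ∀ η : 𝓢(E, ℝ),
      (∀ x, η x = ψ x * f (t • x)) → SchwartzMap.seminorm ℝ i.1 i.2 η ≤ M * t ^ k := by
    rintro ⟨p, n⟩
    choose C hC hCf using fun n => hf.norm_iteratedFDeriv_comp_smul_le n
    set Q : ℝ := 2 ^ (p + k) *
      (Finset.Iic (p + k, n)).sup (fun m => SchwartzMap.seminorm ℝ m.1 m.2) ψ with hQ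
    have hQ0 : 0 ≤ Q := by positivity
    refine ⟨∑ i ∈ range (n + 1), (n.choose i : ℝ) * (Q * C (n - i)),
      Finset.sum_nonneg fun i _ => mul_nonneg (by positivity) (mul_nonneg hQ0 (hC _)),
      fun t ht ht1 η hη => ?_⟩
    refine SchwartzMap.seminorm_le_bound ℝ p n η
      (mul_nonneg (Finset.sum_nonneg fun i _ =>
        mul_nonneg (by positivity) (mul_nonneg hQ0 (hC _))) (by positivity)) fun x => ?_
    have hη' : (η : E → ℝ) = fun x => ψ x * f (t • x) := funext hη
    have hsm : ContDiff ℝ ∞ fun x => f (t • x) := hf.1.comp (contDiff_const_smul t)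
    have hn : (n : ℕ∞ω) ≤ ∞ := mod_cast le_top
    rw [hη']
    refine (mul_le_mul_of_nonneg_left
      (norm_iteratedFDeriv_mul_le (ψ.smooth ⊤) hsm x hn) (by positivity)).trans ?_
    rw [Finset.mul_sum, Finset.sum_mul]
    refine Finset.sum_le_sum fun i hi => ?_
    have hi' : i ≤ n := by simpa [Nat.lt_succ_iff] using hi
    have h1 := SchwartzMap.one_add_le_sup_seminorm_apply (𝕜 := ℝ) (m := (p + k, n))
      (k := p + k) (n := i) le_rfl hi' ψ x
    have h2 := hCf (n - i) t ht ht1 x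
    have hxp : ‖x‖ ^ p ≤ (1 + ‖x‖) ^ p := by gcongr; linarith
    have := hC (n - i)
    calc ‖x‖ ^ p * ((n.choose i : ℝ) * ‖iteratedFDeriv ℝ i ψ x‖ *
          ‖iteratedFDeriv ℝ (n - i) (fun x => f (t • x)) x‖)
        ≤ (1 + ‖x‖) ^ p * ((n.choose i : ℝ) * ‖iteratedFDeriv ℝ i ψ x‖ *
          (C (n - i) * t ^ k * (1 + ‖x‖) ^ k)) := by gcongr
      _ = (n.choose i : ℝ) * (((1 + ‖x‖) ^ (p + k) * ‖iteratedFDeriv ℝ i ψ x‖) * C (n - i)) *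
          t ^ k := by ring
      _ ≤ (n.choose i : ℝ) * (Q * C (n - i)) * t ^ k := by gcongr
  choose M hM hMb using key
  refine ⟨D * ∑ i ∈ s, M i, mul_nonneg D.2 (Finset.sum_nonneg fun i _ => hM i),
    fun t ht ht1 η hη => ?_⟩
  have h1 : |S η| ≤ D * (s.sup (schwartzSeminormFamily ℝ E ℝ)) η := hD η
  refine h1.trans ?_
  rw [mul_assoc]
  refine mul_le_mul_of_nonneg_left (Seminorm.finset_sup_apply_le
    (mul_nonneg (Finset.sum_nonneg fun i _ => hM i) (by positivity)) fun i hi => ?_) D.2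
  refine (hMb i t ht ht1 η hη).trans ?_
  gcongr
  exact Finset.single_le_sum (fun i _ => hM i) hi

end Flatness

section Localization

variable {E : Type} [NormedAddCommGroup E] [InnerProductSpace ℝ E]

lemma eq_zero_of_forall_abs_le_mul {a C : ℝ} (h : ∀ t : ℝ, 0 < t → t ≤ 1 → |a| ≤ C * t) :
    a = 0 := by
  have hlim : Filter.Tendsto (fun t : ℝ => C * t) (𝓝[>] 0) (𝓝 0) := by
    have : Filter.Tendsto (fun t : ℝ => C * t) (𝓝 0) (𝓝 (C * 0)) :=
      (continuous_const_mul C).tendsto 0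
    rw [mul_zero] at this
    exact this.mono_left nhdsWithin_le_nhds
  refine abs_nonpos_iff.1 (ge_of_tendsto hlim ?_)
  filter_upwards [Ioc_mem_nhdsGT (zero_lt_one' ℝ)] with t ht using h t ht.1 ht.2

lemma eventually_nhds_zero_smul {p : E → Prop} (h : ∀ᶠ x in 𝓝 0, p x) (a : ℝ) :
    ∀ᶠ x in 𝓝 (0 : E), p (a • x) := by
  have : Filter.Tendsto (fun x : E => a • x) (𝓝 0) (𝓝 0) := by
    simpa using (continuous_const_smul a).tendsto (0 : E)
  exact this.eventually h

/-- The tempered distribution `S` annihilates every multiple of `‖x‖²` by a function vanishing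
at `0`. -/
def KillsSq (S : 𝓢(E, ℝ) →L[ℝ] ℝ) : Prop :=
  ∀ φ ψ : 𝓢(E, ℝ), (∀ x, ψ x = ‖x‖ ^ 2 * φ x) → φ 0 = 0 → S ψ = 0

lemma KillsSq.apply_eq_zero_of_hasCompactSupport {S : 𝓢(E, ℝ) →L[ℝ] ℝ} (hS : KillsSq S)
    {ψ : 𝓢(E, ℝ)} (hc : HasCompactSupport ψ) (h : ∀ᶠ x in 𝓝 0, ψ x = 0) : S ψ = 0 := by
  have hsm : ContDiff ℝ ∞ fun x => (‖x‖ ^ 2)⁻¹ * ψ x := by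
    rw [contDiff_iff_contDiffAt]
    intro x
    rcases eq_or_ne x 0 with rfl | hx
    · refine (contDiffAt_const (c := (0 : ℝ))).congr_of_eventuallyEq ?_
      filter_upwards [h] with x hx
      rw [hx, mul_zero]
    · exact ((contDiff_norm_sq ℝ).contDiffAt.inv (by simpa using hx)).mul (ψ.smooth ⊤).contDiffAt
  refine hS (hc.mul_left.toSchwartzMap hsm) ψ (fun x => ?_) ?_
  · rcases eq_or_ne x 0 with rfl | hx
    · simpa using h.self_of_nhds
    · have : ‖x‖ ^ 2 ≠ 0 := by simpa using hx
      simp [this]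
  · simp

/-- `S` is homogeneous of the same degree as the second derivatives of the delta distribution. -/
def HomogeneousLikeSecondDeriv (S : 𝓢(E, ℝ) →L[ℝ] ℝ) : Prop :=
  ∀ a : ℝ, 0 < a → ∀ φ ψ : 𝓢(E, ℝ), (∀ x, ψ x = φ (a⁻¹ • x)) → S ψ = (a ^ 2)⁻¹ * S φ

/-- Precomposition of a Schwartz function with a nonzero dilation. -/
noncomputable def dilate (t : ℝ) (ht : t ≠ 0) (φ : 𝓢(E, ℝ)) : 𝓢(E, ℝ) :=
  SchwartzMap.compCLMOfContinuousLinearEquiv ℝ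
    (ContinuousLinearEquiv.smulLeft (M₁ := E) (Units.mk0 t ht)) φ

lemma dilate_apply (t : ℝ) (ht : t ≠ 0) (φ : 𝓢(E, ℝ)) (x : E) : dilate t ht φ x = φ (t • x) := rfl

lemma HomogeneousLikeSecondDeriv.apply_dilate {S : 𝓢(E, ℝ) →L[ℝ] ℝ}
    (hS : HomogeneousLikeSecondDeriv S) (t : ℝ) (ht : 0 < t) (φ : 𝓢(E, ℝ)) :
    S (dilate t ht.ne' φ) = t ^ 2 * S φ := by
  rw [hS t⁻¹ (inv_pos.2 ht) φ _ fun x => by rw [dilate_apply, inv_inv]]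
  simp

variable [FiniteDimensional ℝ E]

/-- A smooth cutoff function: equal to `1` on the unit ball, supported in the ball of radius `2`. -/
noncomputable def unitBump (E : Type) [NormedAddCommGroup E] : ContDiffBump (0 : E) :=
  ⟨1, 2, one_pos, one_lt_two⟩

lemma unitBump_eventuallyEq_one : ∀ᶠ x in 𝓝 (0 : E), unitBump E x = 1 :=
  (unitBump E).eventuallyEq_one

/-- The product of a smooth function with the cutoff function, as a Schwartz function. -/
noncomputable def localize (f : E → ℝ) (hf : ContDiff ℝ ∞ f) : 𝓢(E, ℝ) :=
  HasCompactSupport.toSchwartzMap (f := fun x => unitBump E x * f x)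
    (unitBump E).hasCompactSupport.mul_right ((unitBump E).contDiff.mul hf)

lemma localize_apply (f : E → ℝ) (hf : ContDiff ℝ ∞ f) (x : E) :
    localize f hf x = unitBump E x * f x := rfl

lemma localize_eventuallyEq (f : E → ℝ) (hf : ContDiff ℝ ∞ f) :
    ∀ᶠ x in 𝓝 0, localize f hf x = f x := by
  filter_upwards [unitBump_eventuallyEq_one] with x hx
  rw [localize_apply, hx, one_mul]

lemma KillsSq.apply_eq_zero {S : 𝓢(E, ℝ) →L[ℝ] ℝ} (hS : KillsSq S)
    {ψ : 𝓢(E, ℝ)} (h : ∀ᶠ x in 𝓝 0, ψ x = 0) : S ψ = 0 := by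
  have hχ : FlatOfOrder 1 fun x => localize (fun _ : E => (1 : ℝ)) contDiff_const x - 1 := by
    have h0 := (SchwartzMap.flatOfOrder_zero
      (localize (fun _ : E => (1 : ℝ)) contDiff_const)).sub_const 1
    refine .of_fderiv h0.1 ?_ h0.fderiv
    have := (localize_eventuallyEq (fun _ : E => (1 : ℝ)) contDiff_const).self_of_nhds
    simp [this]
  obtain ⟨C, hC, hb⟩ := hχ.exists_abs_le S ψ
  have key : ∀ t : ℝ, 0 < t → t ≤ 1 → |S ψ| ≤ C * t := by
    intro t ht ht1
    have hcs : HasCompactSupport fun x : E => ψ x * unitBump E (t • x) :=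
      HasCompactSupport.mul_left
        ((unitBump E).hasCompactSupport.comp_homeomorph (Homeomorph.smulOfNeZero t ht.ne'))
    have hsm : ContDiff ℝ ∞ fun x : E => ψ x * unitBump E (t • x) :=
      (ψ.smooth ⊤).mul ((unitBump E).contDiff.comp (contDiff_const_smul t))
    set ρ : 𝓢(E, ℝ) := hcs.toSchwartzMap hsm with hρ
    have hρ0 : S ρ = 0 := by
      refine hS.apply_eq_zero_of_hasCompactSupport hcs ?_
      filter_upwards [h] with x hx
      simp [hρ, hx]
    have := hb t ht ht1 (ρ - ψ) fun x => by
      simp [hρ, localize_apply]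
      ring
    simpa [hρ0] using this
  exact eq_zero_of_forall_abs_le_mul key

lemma KillsSq.congr {S : 𝓢(E, ℝ) →L[ℝ] ℝ} (hS : KillsSq S)
    {φ ψ : 𝓢(E, ℝ)} (h : ∀ᶠ x in 𝓝 0, φ x = ψ x) : S φ = S ψ := by
  rw [← sub_eq_zero, ← map_sub]
  refine hS.apply_eq_zero ?_
  filter_upwards [h] with x hx
  simp [hx]

lemma KillsSq.localize_eq_zero {S : 𝓢(E, ℝ) →L[ℝ] ℝ} (hS : KillsSq S)
    (hhom : HomogeneousLikeSecondDeriv S) {f : E → ℝ} (hf : ContDiff ℝ ∞ f) {d : ℕ} (hd : d < 2)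
    (hfd : ∀ x, f ((2 : ℝ) • x) = 2 ^ d * f x) : S (localize f hf) = 0 := by
  have h1 := hhom.apply_dilate 2 two_pos (localize f hf)
  have h2 : S (dilate 2 two_ne_zero (localize f hf)) = S ((2 ^ d : ℝ) • localize f hf) := by
    refine hS.congr ?_
    filter_upwards [localize_eventuallyEq f hf,
      eventually_nhds_zero_smul (localize_eventuallyEq f hf) 2] with x hx hx2
    simp [dilate_apply, hx, hx2, hfd]
  rw [h2, map_smul, smul_eq_mul] at h1
  interval_cases d <;> linarith

/-- A distribution supported at the origin, homogeneous like a second derivative of the delta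
distribution, only sees the quadratic part of the Taylor expansion. -/
lemma KillsSq.apply_eq_localize_hessian {S : 𝓢(E, ℝ) →L[ℝ] ℝ} (hS : KillsSq S)
    (hhom : HomogeneousLikeSecondDeriv S) (φ : 𝓢(E, ℝ))
    (hB : ContDiff ℝ ∞ fun x => fderiv ℝ (fderiv ℝ φ) 0 x x) :
    S φ = (1 / 2 : ℝ) * S (localize (fun x => fderiv ℝ (fderiv ℝ φ) 0 x x) hB) := by
  set L := fderiv ℝ φ 0 with hL
  set B := fderiv ℝ (fderiv ℝ φ) 0 with hBdef
  have hsymm : ∀ v w, B v w = B w v := fun v w =>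
    (((φ.smooth ⊤).contDiffAt (x := 0)).isSymmSndFDerivAt
      (by simpa using ENat.LEInfty.out)) v w
  have hφ0 := φ.flatOfOrder_zero
  have hd1 : Differentiable ℝ φ := (φ.smooth ⊤).differentiable (by simp)
  have hd2 : Differentiable ℝ (fderiv ℝ φ) := hφ0.fderiv.1.differentiable (by simp)
  set G : E → ℝ := fun x => φ x - φ 0 - L x - (1 / 2 : ℝ) * B x x with hG
  have hGsm : ContDiff ℝ ∞ G :=
    (((φ.smooth ⊤).sub contDiff_const).sub L.contDiff).sub (contDiff_const.mul hB)
  have hG1 : fderiv ℝ G = fun x => fderiv ℝ φ x - L - B x := by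
    funext x
    have hq : HasFDerivAt (fun x => B x x) (B x + B.flip x) x :=
      (B.hasFDerivAt.clm_apply (hasFDerivAt_id x)).congr_fderiv (by ext v; simp)
    have hder := (((hd1 x).hasFDerivAt.sub_const (φ 0)).sub L.hasFDerivAt).sub
      (hq.const_mul (1 / 2 : ℝ))
    refine hder.fderiv.trans ?_
    ext v
    simp [hsymm v x]
    ring
  have hG2 : fderiv ℝ (fun x => fderiv ℝ φ x - L - B x) = fun x =>
      fderiv ℝ (fderiv ℝ φ) x - B := by
    funext x
    exact (((hd2 x).hasFDerivAt.sub_const L).sub B.hasFDerivAt).fderiv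
  have flat1 : FlatOfOrder 1 fun x => fderiv ℝ (fderiv ℝ φ) x - B :=
    have h := hφ0.fderiv.fderiv.sub_const B
    .of_fderiv h.1 (by simp [hBdef]) h.fderiv
  have flat2 : FlatOfOrder 2 fun x => fderiv ℝ φ x - L - B x :=
    .of_fderiv ((hφ0.fderiv.1.sub contDiff_const).sub B.contDiff) (by simp [hL])
      (by rw [hG2]; exact flat1)
  have flat3 : FlatOfOrder 3 G := .of_fderiv hGsm (by simp [hG]) (by rw [hG1]; exact flat2)
  set χ := localize (fun _ : E => (1 : ℝ)) contDiff_const with hχ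
  obtain ⟨C, hC, hb⟩ := flat3.exists_abs_le S χ
  set q := S (localize (fun x => B x x) hB) with hq
  have key : ∀ t : ℝ, 0 < t → t ≤ 1 → |S φ - 1 / 2 * q| ≤ C * t := by
    intro t ht ht1
    have hGt : ContDiff ℝ ∞ fun x => G (t • x) := hGsm.comp (contDiff_const_smul t)
    have h1 := hb t ht ht1 (localize _ hGt) fun x => by simp [hχ, localize_apply]
    have h2 : S (dilate t ht.ne' φ) = S (φ 0 • χ + t • localize L L.contDiff +
        (t ^ 2 / 2) • localize (fun x => B x x) hB + localize _ hGt) := by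
      refine hS.congr ?_
      filter_upwards [unitBump_eventuallyEq_one] with x hx
      simp [dilate_apply, hχ, localize_apply, hx, hG]
      ring
    have hχ0 : S χ = 0 := hS.localize_eq_zero hhom _ (d := 0) (by simp) (by simp)
    have hL0 : S (localize L L.contDiff) = 0 :=
      hS.localize_eq_zero hhom _ (d := 1) (by simp) (by simp)
    rw [hhom.apply_dilate t ht] at h2
    simp only [map_add, map_smul, smul_eq_mul, hχ0, hL0, mul_zero, zero_add, ← hq] at h2
    have h3 : S (localize _ hGt) = t ^ 2 * (S φ - 1 / 2 * q) := by linarith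
    rw [h3, abs_mul, abs_of_pos (by positivity : 0 < t ^ 2)] at h1
    refine le_of_mul_le_mul_left (h1.trans_eq ?_) (by positivity : 0 < t ^ 2)
    ring
  exact sub_eq_zero.1 (eq_zero_of_forall_abs_le_mul key)

end Localization

section Rotations

variable {m : ℕ}

/-- `S` is invariant under linear isometries. -/
def RotationInvariant (S : 𝓢(EuclideanSpace ℝ (Fin m), ℝ) →L[ℝ] ℝ) : Prop :=
  ∀ (A : EuclideanSpace ℝ (Fin m) ≃ₗᵢ[ℝ] EuclideanSpace ℝ (Fin m))
    (φ ψ : 𝓢(EuclideanSpace ℝ (Fin m), ℝ)), (∀ x, ψ x = φ (A x)) → S ψ = S φ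

lemma contDiff_coord_mul_coord (i j : Fin m) :
    ContDiff ℝ ∞ fun x : EuclideanSpace ℝ (Fin m) => x i * x j := by
  fun_prop

lemma KillsSq.localize_comp {S : 𝓢(EuclideanSpace ℝ (Fin m), ℝ) →L[ℝ] ℝ} (hS : KillsSq S)
    (hrot : RotationInvariant S) (A : EuclideanSpace ℝ (Fin m) ≃ₗᵢ[ℝ] EuclideanSpace ℝ (Fin m))
    {f g : EuclideanSpace ℝ (Fin m) → ℝ} (hf : ContDiff ℝ ∞ f) (hg : ContDiff ℝ ∞ g)
    (h : ∀ x, g x = f (A x)) : S (localize g hg) = S (localize f hf) := by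
  rw [← hrot A (localize f hf) (SchwartzMap.compCLMOfContinuousLinearEquiv ℝ
    A.toContinuousLinearEquiv (localize f hf)) fun x => rfl]
  refine hS.congr ?_
  have hA : Filter.Tendsto A (𝓝 0) (𝓝 0) := by simpa using A.continuous.tendsto 0
  filter_upwards [localize_eventuallyEq g hg, hA.eventually (localize_eventuallyEq f hf)]
    with x hx hx'
  rw [hx, h, ← hx']
  rfl

lemma KillsSq.localize_coord_mul_coord_of_ne {S : 𝓢(EuclideanSpace ℝ (Fin m), ℝ) →L[ℝ] ℝ}
    (hS : KillsSq S) (hrot : RotationInvariant S) {i j : Fin m} (hij : i ≠ j) :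
    S (localize _ (contDiff_coord_mul_coord i j)) = 0 := by
  have hneg : ContDiff ℝ ∞ fun x : EuclideanSpace ℝ (Fin m) => -(x i * x j) :=
    (contDiff_coord_mul_coord i j).neg
  have h := hS.localize_comp hrot (LinearIsometryEquiv.piLpCongrRight 2 fun k =>
    if k = i then LinearIsometryEquiv.neg ℝ else LinearIsometryEquiv.refl ℝ ℝ)
    (contDiff_coord_mul_coord i j) hneg fun x => by
      simp [LinearIsometryEquiv.piLpCongrRight_apply, hij.symm]
  have h' : localize _ hneg = -localize _ (contDiff_coord_mul_coord i j) := by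
    ext x
    simp [localize_apply]
  rw [h', map_neg] at h
  linarith

lemma KillsSq.localize_coord_sq_eq {S : 𝓢(EuclideanSpace ℝ (Fin m), ℝ) →L[ℝ] ℝ}
    (hS : KillsSq S) (hrot : RotationInvariant S) (i j : Fin m) :
    S (localize _ (contDiff_coord_mul_coord i i)) =
      S (localize _ (contDiff_coord_mul_coord j j)) :=
  hS.localize_comp hrot (LinearIsometryEquiv.piLpCongrLeft 2 ℝ ℝ (Equiv.swap i j)) _ _ fun x => by
    simp [LinearIsometryEquiv.piLpCongrLeft_apply, Equiv.piCongrLeft'_apply]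

lemma sum_localize_coord_sq (S : 𝓢(EuclideanSpace ℝ (Fin m), ℝ) →L[ℝ] ℝ)
    (hmul : ∀ φ ψ : 𝓢(EuclideanSpace ℝ (Fin m), ℝ),
      (∀ x, ψ x = ‖x‖ ^ 2 * φ x) → S ψ = -(m : ℝ) * φ 0) :
    ∑ i, S (localize _ (contDiff_coord_mul_coord i i)) = -(m : ℝ) := by
  rw [← map_sum, hmul (localize (fun _ => 1) contDiff_const) _ fun x => ?_]
  · rw [(localize_eventuallyEq _ contDiff_const).self_of_nhds, mul_one]
  · rw [EuclideanSpace.real_norm_sq_eq, _root_.sum_apply, Finset.sum_mul]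
    refine Finset.sum_congr rfl fun i _ => ?_
    rw [localize_apply, localize_apply]
    ring

lemma bilin_apply_self_eq_sum
    (B : EuclideanSpace ℝ (Fin m) →L[ℝ] EuclideanSpace ℝ (Fin m) →L[ℝ] ℝ)
    (x : EuclideanSpace ℝ (Fin m)) :
    B x x = ∑ i, ∑ j,
      B (EuclideanSpace.single i 1) (EuclideanSpace.single j 1) * (x i * x j) := by
  have hx : x = ∑ i, x i • EuclideanSpace.single i (1 : ℝ) := by
    simpa using ((EuclideanSpace.basisFun (Fin m) ℝ).sum_repr x).symm
  conv_lhs => rw [hx]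
  simp only [map_sum, map_smul, _root_.sum_apply, _root_.smul_apply,
    smul_eq_mul, Finset.mul_sum]
  rw [Finset.sum_comm]
  refine Finset.sum_congr rfl fun i _ => Finset.sum_congr rfl fun j _ => ?_
  ring

lemma laplacian_eq_sum_hessian {φ : EuclideanSpace ℝ (Fin m) → ℝ} (hφ : ContDiff ℝ ∞ φ)
    (x : EuclideanSpace ℝ (Fin m)) :
    laplacian φ x = ∑ j, fderiv ℝ (fderiv ℝ φ) x
      (EuclideanSpace.single j 1) (EuclideanSpace.single j 1) := by
  have hd : DifferentiableAt ℝ (fderiv ℝ φ) x :=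
    ((hφ.fderiv_right (m := ∞) (by simp)).differentiable (by simp)) x
  refine Finset.sum_congr rfl fun j _ => ?_
  rw [fderiv_clm_apply hd (differentiableAt_const _)]
  simp

end Rotations

/-- (r⁻¹ ∂_r) δ(x) = −(1/2) Δ δ(x): any rotation-invariant tempered distribution,
homogeneous of degree −(m+2), with r²·S = −m δ, equals −(1/2) Δδ. -/
theorem inv_r_radial_derivative_of_delta (m : ℕ) (hm : 2 ≤ m)
    (S : 𝓢(EuclideanSpace ℝ (Fin m), ℝ) →L[ℝ] ℝ)
    (hrot : ∀ (A : EuclideanSpace ℝ (Fin m) ≃ₗᵢ[ℝ] EuclideanSpace ℝ (Fin m))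
      (φ ψ : 𝓢(EuclideanSpace ℝ (Fin m), ℝ)), (∀ x, ψ x = φ (A x)) → S ψ = S φ)
    (hhom : ∀ a : ℝ, 0 < a → ∀ φ ψ : 𝓢(EuclideanSpace ℝ (Fin m), ℝ),
      (∀ x, ψ x = φ (a⁻¹ • x)) → S ψ = (a ^ 2)⁻¹ * S φ)
    (hmul : ∀ φ ψ : 𝓢(EuclideanSpace ℝ (Fin m), ℝ),
      (∀ x, ψ x = ‖x‖ ^ 2 * φ x) → S ψ = -(m : ℝ) * φ 0) :
    ∀ φ : 𝓢(EuclideanSpace ℝ (Fin m), ℝ),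
      S φ = -(1 / 2 : ℝ) * laplacian (⇑φ) 0 := by
  intro φ
  have hS : KillsSq S := fun φ ψ h h0 => by rw [hmul φ ψ h, h0, mul_zero]
  have hm0 : (m : ℝ) ≠ 0 := by positivity
  set B := fderiv ℝ (fderiv ℝ φ) 0 with hBdef
  have hB : ContDiff ℝ ∞ fun x => B x x := B.contDiff.clm_apply contDiff_id
  have hone : ∀ i : Fin m, S (localize _ (contDiff_coord_mul_coord i i)) = -1 := by
    intro i
    have h := sum_localize_coord_sq S hmul
    rw [Finset.sum_congr rfl fun j _ => hS.localize_coord_sq_eq hrot j i] at h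
    simp only [Finset.sum_const, Finset.card_univ, Fintype.card_fin, nsmul_eq_mul] at h
    exact mul_left_cancel₀ hm0 (by linarith)
  have hsum : localize _ hB = ∑ i : Fin m, ∑ j : Fin m,
      B (EuclideanSpace.single i 1) (EuclideanSpace.single j 1) •
        localize _ (contDiff_coord_mul_coord i j) := by
    ext x
    simp only [localize_apply, _root_.sum_apply, _root_.smul_apply, smul_eq_mul,
      bilin_apply_self_eq_sum B x, Finset.mul_sum]
    refine Finset.sum_congr rfl fun i _ => Finset.sum_congr rfl fun j _ => ?_
    ring
  have hdiag : S (localize _ hB) =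
      ∑ i : Fin m, -B (EuclideanSpace.single i 1) (EuclideanSpace.single i 1) := by
    rw [hsum, map_sum]
    refine Finset.sum_congr rfl fun i _ => ?_
    rw [map_sum, Finset.sum_eq_single i]
    · rw [map_smul, hone, smul_eq_mul, mul_neg_one]
    · intro j _ hj
      rw [map_smul, hS.localize_coord_mul_coord_of_ne hrot hj.symm, smul_zero]
    · simp
  rw [hS.apply_eq_localize_hessian hhom φ hB, hdiag, laplacian_eq_sum_hessian (φ.smooth ⊤),
    Finset.sum_neg_distrib]
  ring
end

section
/- Let m ≥ 1 and let ℓ be a natural number. For every Schwartz function φ : ℝ^m → ℝ, all even-order derivatives at r = 0 of the spherical mean of the second kind Σ¹[φ](r) = a_m⁻¹ ∫_{S^{m−1}} φ(r • ω) • ω dσ(ω) vanish: (d/dr)^{2ℓ} Σ¹[φ](0) = 0 in ℝ^m. -/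
open MeasureTheory Metric Finset
open scoped SchwartzMap

/-- The canonical surface measure on the unit sphere `S^{m-1}` in `ℝ^m`. -/
noncomputable def sphereMeasure (m : ℕ) :
    Measure (sphere (0 : EuclideanSpace ℝ (Fin m)) 1) :=
  (volume : Measure (EuclideanSpace ℝ (Fin m))).toSphere

/-- The spherical mean `Σ⁰[φ](r) = aₘ⁻¹ ∫_{S^{m-1}} φ(r • ω) dσ(ω)`. -/
noncomputable def sphMean0 {m : ℕ} (φ : EuclideanSpace ℝ (Fin m) → ℝ) (r : ℝ) : ℝ :=
  ((sphereMeasure m) Set.univ).toReal⁻¹ *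
    ∫ ω : sphere (0 : EuclideanSpace ℝ (Fin m)) 1,
      φ (r • (ω : EuclideanSpace ℝ (Fin m))) ∂(sphereMeasure m)

/-- The spherical mean of the second kind
`Σ¹[φ](r) = aₘ⁻¹ ∫_{S^{m-1}} φ(r • ω) • ω dσ(ω)`. -/
noncomputable def sphMean1 {m : ℕ} (φ : EuclideanSpace ℝ (Fin m) → ℝ) (r : ℝ) :
    EuclideanSpace ℝ (Fin m) :=
  ((sphereMeasure m) Set.univ).toReal⁻¹ •
    ∫ ω : sphere (0 : EuclideanSpace ℝ (Fin m)) 1,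
      φ (r • (ω : EuclideanSpace ℝ (Fin m))) • (ω : EuclideanSpace ℝ (Fin m)) ∂(sphereMeasure m)

/-- The measure on the unit sphere induced by a negation-invariant measure is negation-invariant. -/
theorem measurePreserving_neg_toSphere {E : Type*} [NormedAddCommGroup E] [NormedSpace ℝ E]
    [MeasurableSpace E] [BorelSpace E] (μ : Measure E) [μ.IsNegInvariant] :
    MeasurePreserving (fun ω : sphere (0 : E) 1 => -ω) μ.toSphere μ.toSphere := by
  refine ⟨continuous_neg.measurable, Measure.ext fun s hs => ?_⟩
  have hs' : MeasurableSet ((fun ω : sphere (0 : E) 1 => -ω) ⁻¹' s) :=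
    continuous_neg.measurable hs
  rw [Measure.map_apply continuous_neg.measurable hs, μ.toSphere_apply' hs', μ.toSphere_apply' hs]
  congr 1
  rw [← Measure.measure_neg μ]
  congr 1
  ext x
  simp only [Set.mem_neg, Set.mem_smul, Set.mem_image, Set.mem_preimage]
  constructor
  · rintro ⟨t, ht, _, ⟨ω, hω, rfl⟩, h⟩
    exact ⟨t, ht, _, ⟨-ω, hω, rfl⟩, by simp [h]⟩
  · rintro ⟨t, ht, _, ⟨ω, hω, rfl⟩, h⟩
    exact ⟨t, ht, _, ⟨-ω, by simpa using hω, rfl⟩, by simp [h]⟩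

/-- The spherical mean of the second kind is an odd function of the radius. -/
theorem sphMean1_neg {m : ℕ} (φ : EuclideanSpace ℝ (Fin m) → ℝ) (r : ℝ) :
    sphMean1 φ (-r) = -sphMean1 φ r := by
  unfold sphMean1 sphereMeasure
  rw [← smul_neg, ← integral_neg, ← (measurePreserving_neg_toSphere volume).integral_comp
    (Homeomorph.neg _).measurableEmbedding]
  simp

/-- Even-order derivatives at the origin of an odd function vanish. -/
theorem iteratedDeriv_even_eq_zero_of_odd {F : Type*} [NormedAddCommGroup F] [NormedSpace ℝ F]
    {f : ℝ → F} (hf : ∀ r, f (-r) = -f r) {n : ℕ} (hn : Even n) :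
    iteratedDeriv n f 0 = 0 := by
  have h := iteratedDeriv_comp_neg n f 0
  simp only [hf, iteratedDeriv_fun_neg, hn.neg_one_pow, one_smul, neg_zero] at h
  have : IsAddTorsionFree F := .of_isTorsionFree ℝ F
  exact self_eq_neg.mp h.symm

/-- All even-order derivatives at r = 0 of the spherical mean of the second kind
Σ¹[φ] vanish. -/
theorem sphMean1_even_derivatives_vanish (m ℓ : ℕ) (hm : 1 ≤ m)
    (φ : 𝓢(EuclideanSpace ℝ (Fin m), ℝ)) :
    iteratedDeriv (2 * ℓ) (sphMean1 ⇑φ) 0 = 0 := by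
  exact iteratedDeriv_even_eq_zero_of_odd (sphMean1_neg φ) (even_two_mul ℓ)
end

section
/- Let m ≥ 1 and let φ : ℝ^m → ℝ be a Schwartz function. Then the spherical mean Σ⁰[φ] : ℝ → ℝ, Σ⁰[φ](r) = a_m⁻¹ ∫_{S^{m−1}} φ(r • ω) dσ(ω), is a smooth function of r on all of ℝ, it is even, i.e. Σ⁰[φ](−r) = Σ⁰[φ](r) for all r ∈ ℝ, and Σ⁰[φ](0) = φ(0). -/
open MeasureTheory Metric Finset
open scoped SchwartzMap

/-- The integral over a compact set of a smooth integrand depending on a real parameter can be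
differentiated under the integral sign. -/
theorem hasDerivAt_integral_of_contDiff {E : Type*} [NormedAddCommGroup E] [NormedSpace ℝ E]
    [MeasurableSpace E] [BorelSpace E] {K : Set E} (hK : IsCompact K)
    (μ : Measure K) [IsFiniteMeasure μ] {Ψ : ℝ × E → ℝ} (hΨ : ContDiff ℝ 1 Ψ) (r : ℝ) :
    HasDerivAt (fun s => ∫ ω : K, Ψ (s, ω) ∂μ) (∫ ω : K, fderiv ℝ Ψ (r, ω) (1, 0) ∂μ) r := by
  have : CompactSpace K := isCompact_iff_compactSpace.mp hK
  have hΨ' : Continuous fun p => fderiv ℝ Ψ p (1, 0) :=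
    (hΨ.continuous_fderiv one_ne_zero).clm_apply continuous_const
  obtain ⟨C, hC⟩ := ((isCompact_closedBall r 1).prod hK).exists_bound_of_continuousOn
    hΨ'.continuousOn
  have hslice (s : ℝ) : Continuous fun ω : K => Ψ (s, ω) := hΨ.continuous.comp (by fun_prop)
  have hslice' : Continuous fun ω : K => fderiv ℝ Ψ (r, ω) (1, 0) :=
    hΨ'.comp (f := fun ω : K => (r, (ω : E))) (by fun_prop)
  refine (hasDerivAt_integral_of_dominated_loc_of_deriv_le (bound := fun _ => C)
    (F' := fun s (ω : K) => fderiv ℝ Ψ (s, ω) (1, 0)) (closedBall_mem_nhds r one_pos)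
    (.of_forall fun s => (hslice s).aestronglyMeasurable_of_compactSpace) ?_
    hslice'.aestronglyMeasurable_of_compactSpace
    (.of_forall fun ω s hs => hC _ ⟨hs, ω.2⟩) (integrable_const C)
    (.of_forall fun ω s _ => ?_)).2
  · exact (hslice r).integrable_of_hasCompactSupport (HasCompactSupport.of_compactSpace _)
  · exact (hΨ.differentiable one_ne_zero (s, (ω : E))).hasFDerivAt.comp_hasDerivAt s
      ((hasDerivAt_id s).prodMk (hasDerivAt_const s (ω : E)))

/-- The integral over a compact set of a smooth integrand depending on a real parameter is a smooth
function of the parameter. -/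
theorem contDiff_integral_of_contDiff {E : Type*} [NormedAddCommGroup E] [NormedSpace ℝ E]
    [MeasurableSpace E] [BorelSpace E] {K : Set E} (hK : IsCompact K)
    (μ : Measure K) [IsFiniteMeasure μ] {Ψ : ℝ × E → ℝ} (hΨ : ContDiff ℝ (⊤ : ℕ∞) Ψ) :
    ContDiff ℝ (⊤ : ℕ∞) fun r => ∫ ω : K, Ψ (r, ω) ∂μ := by
  refine contDiff_infty.mpr fun n => ?_
  induction n generalizing Ψ with
  | zero =>
    refine contDiff_zero.mpr (continuous_iff_continuousAt.mpr fun r => ?_)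
    exact (hasDerivAt_integral_of_contDiff hK μ (hΨ.of_le (by simp)) r).continuousAt
  | succ n ih =>
    have hderiv := hasDerivAt_integral_of_contDiff hK μ (hΨ.of_le (m := 1) (by simp))
    rw [Nat.cast_succ]
    refine contDiff_succ_iff_deriv.mpr ⟨fun r => (hderiv r).differentiableAt, by simp, ?_⟩
    rw [funext fun r => (hderiv r).deriv]
    exact ih ((hΨ.fderiv_right (by simp)).clm_apply contDiff_const)

open scoped Pointwise in
/-- The surface measure on the unit sphere is invariant under the antipodal map. -/
theorem measurePreserving_neg_sphereMeasure (m : ℕ) :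
    MeasurePreserving Neg.neg (sphereMeasure m) (sphereMeasure m) := by
  refine ⟨continuous_neg.measurable, Measure.ext fun s hs => ?_⟩
  have hs' : MeasurableSet (Neg.neg ⁻¹' s) := continuous_neg.measurable hs
  rw [Measure.map_apply continuous_neg.measurable hs, sphereMeasure,
    Measure.toSphere_apply' _ hs', Measure.toSphere_apply' _ hs,
    ← Measure.measure_neg _ (Set.Ioo (0 : ℝ) 1 • (_ '' s))]
  congr 2
  ext x
  simp only [Set.mem_neg, Set.mem_smul, Set.mem_image, Set.mem_preimage]
  constructor
  · rintro ⟨t, ht, _, ⟨ω, hω, rfl⟩, rfl⟩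
    exact ⟨t, ht, _, ⟨-ω, hω, rfl⟩, by simp⟩
  · rintro ⟨t, ht, _, ⟨ω, hω, rfl⟩, h⟩
    exact ⟨t, ht, _, ⟨-ω, by simpa using hω, rfl⟩, by simp [h]⟩

/-- The spherical mean Σ⁰[φ] of a Schwartz function is smooth, even,
and Σ⁰[φ](0) = φ(0). -/
theorem sphMean0_smooth_even (m : ℕ) (hm : 1 ≤ m)
    (φ : 𝓢(EuclideanSpace ℝ (Fin m), ℝ)) :
    ContDiff ℝ (⊤ : ℕ∞) (sphMean0 ⇑φ) ∧ (∀ r : ℝ, sphMean0 ⇑φ (-r) = sphMean0 ⇑φ r) ∧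
      sphMean0 ⇑φ 0 = φ 0 := by
  have : Nonempty (Fin m) := ⟨⟨0, hm⟩⟩
  have : IsFiniteMeasure (sphereMeasure m) := by unfold sphereMeasure; infer_instance
  refine ⟨?_, fun r => ?_, ?_⟩
  · refine contDiff_const.mul (contDiff_integral_of_contDiff
      (Ψ := fun p : ℝ × EuclideanSpace ℝ (Fin m) => φ (p.1 • p.2)) (isCompact_sphere _ _) _ ?_)
    exact (φ.smooth _).comp (contDiff_fst.smul contDiff_snd)
  · unfold sphMean0
    rw [← (measurePreserving_neg_sphereMeasure m).integral_comp
      (Homeomorph.neg _).measurableEmbedding]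
    simp
  · have hne : (sphereMeasure m).real Set.univ ≠ 0 := by
      rw [Measure.real, ENNReal.toReal_ne_zero]
      refine ⟨?_, measure_ne_top _ _⟩
      rw [Ne, Measure.measure_univ_eq_zero]
      exact Measure.toSphere_ne_zero _
    simp only [sphMean0, zero_smul, integral_const, smul_eq_mul]
    exact inv_mul_cancel_left₀ hne _
end

section
/- Let m ≥ 1 and let φ : ℝ^m → ℝ be a Schwartz function. Then the spherical mean of the second kind Σ¹[φ] : ℝ → ℝ^m, Σ¹[φ](r) = a_m⁻¹ ∫_{S^{m−1}} φ(r • ω) • ω dσ(ω), is a smooth ℝ^m-valued function of r on all of ℝ and it is odd, i.e. Σ¹[φ](−r) = −Σ¹[φ](r) for all r ∈ ℝ; in particular Σ¹[φ](0) = 0. -/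
open MeasureTheory Metric Finset
open scoped SchwartzMap

/-- Integrating a jointly smooth function over a compact family of parameters preserves
smoothness in the remaining real variable. -/
theorem contDiff_integral_comp_of_compactSpace {X E G : Type*} [TopologicalSpace X]
    [CompactSpace X] [MeasurableSpace X] [BorelSpace X] [SecondCountableTopology X]
    [NormedAddCommGroup E] [NormedSpace ℝ E] [NormedAddCommGroup G] [NormedSpace ℝ G]
    (μ : Measure X) [IsFiniteMeasure μ] {ι : X → E} (hι : Continuous ι) (n : ℕ)
    {F : ℝ × E → G} (hF : ContDiff ℝ (⊤ : ℕ∞) F) :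
    ContDiff ℝ n (fun r : ℝ => ∫ x, F (r, ι x) ∂μ) := by
  induction n generalizing F with
  | zero =>
    refine contDiff_zero.2 ?_
    have hc : Continuous (Function.uncurry fun (r : ℝ) (x : X) => F (r, ι x)) :=
      hF.continuous.comp (continuous_fst.prodMk (hι.comp continuous_snd))
    simpa using continuous_parametric_integral_of_continuous (μ := μ) hc isCompact_univ
  | succ n ih =>
    let F' : ℝ × E → G := fun p => fderiv ℝ F p (1, 0)
    have hF'_smooth : ContDiff ℝ (⊤ : ℕ∞) F' :=
      (hF.fderiv_right (m := (⊤ : ℕ∞)) le_rfl).clm_apply contDiff_const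
    have hcont {H : ℝ × E → G} (hH : Continuous H) (r : ℝ) : Continuous fun x => H (r, ι x) :=
      hH.comp (continuous_const.prodMk hι)
    have hint {f : X → G} (hf : Continuous f) : Integrable f μ :=
      hf.integrable_of_hasCompactSupport (HasCompactSupport.of_compactSpace f)
    have hderiv (r : ℝ) : HasDerivAt (fun r : ℝ => ∫ x, F (r, ι x) ∂μ)
        (∫ x, F' (r, ι x) ∂μ) r := by
      obtain ⟨C, hC⟩ :=
        ((isCompact_closedBall r 1).prod (isCompact_range hι)).exists_bound_of_continuousOn
          hF'_smooth.continuous.continuousOn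
      refine (hasDerivAt_integral_of_dominated_loc_of_deriv_le (bound := fun _ => C)
        (closedBall_mem_nhds r one_pos)
        (.of_forall fun s => (hint (hcont hF.continuous s)).aestronglyMeasurable)
        (hint (hcont hF.continuous r))
        (hint (hcont hF'_smooth.continuous r)).aestronglyMeasurable
        (.of_forall fun x s hs => hC (s, ι x) ⟨hs, x, rfl⟩)
        (integrable_const C) (.of_forall fun x s _ => ?_)).2
      exact ((hF.differentiable (by simp)).differentiableAt.hasFDerivAt.comp_hasDerivAt s
        ((hasDerivAt_id s).prodMk (hasDerivAt_const s (ι x))))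
    push_cast
    refine contDiff_succ_iff_deriv.2 ⟨fun r => (hderiv r).differentiableAt, by simp, ?_⟩
    rw [funext fun r => (hderiv r).deriv]
    exact ih hF'_smooth

/-- The surface measure on the sphere is invariant under the antipodal map. -/
instance sphereMeasure_isNegInvariant (m : ℕ) : (sphereMeasure m).IsNegInvariant where
  neg_eq_self := by
    ext s hs
    have himage : ((↑) '' (-s) : Set (EuclideanSpace ℝ (Fin m))) = -((↑) '' s) := by
      ext x
      simp only [Set.mem_image, Set.mem_neg]
      exact ⟨fun ⟨y, hy, h⟩ => ⟨-y, hy, by simp [h]⟩, fun ⟨y, hy, h⟩ => ⟨-y, by simpa, by simp [h]⟩⟩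
    rw [Measure.neg_apply, sphereMeasure, Measure.toSphere_apply' _ hs,
      Measure.toSphere_apply' _ (s := -s) (continuous_neg.measurable hs), himage, Set.smul_neg, Measure.measure_neg]

/-- The spherical mean of the second kind Σ¹[φ] of a Schwartz function is smooth
and odd; in particular Σ¹[φ](0) = 0. -/
theorem sphMean1_smooth_odd (m : ℕ) (hm : 1 ≤ m)
    (φ : 𝓢(EuclideanSpace ℝ (Fin m), ℝ)) :
    ContDiff ℝ (⊤ : ℕ∞) (sphMean1 ⇑φ) ∧ (∀ r : ℝ, sphMean1 ⇑φ (-r) = -sphMean1 ⇑φ r) ∧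
      sphMean1 ⇑φ 0 = 0 := by
  have hodd (r : ℝ) : sphMean1 ⇑φ (-r) = -sphMean1 ⇑φ r := by
    unfold sphMean1
    rw [← smul_neg, ← integral_neg, ← (Measure.measurePreserving_neg (sphereMeasure m)).integral_comp
        (Homeomorph.neg _).measurableEmbedding]
    simp
  have hzero : sphMean1 ⇑φ 0 = 0 := by
    have h := eq_neg_iff_add_eq_zero.1 (hodd 0)
    simpa [← two_smul ℝ] using h
  refine ⟨?_, hodd, hzero⟩
  have : IsFiniteMeasure (sphereMeasure m) := by unfold sphereMeasure; infer_instance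
  refine contDiff_infty.2 fun n => ContDiff.const_smul _ ?_
  refine contDiff_integral_comp_of_compactSpace (sphereMeasure m) continuous_subtype_val n
    (F := fun p : ℝ × EuclideanSpace ℝ (Fin m) => φ (p.1 • p.2) • p.2) ?_
  exact (φ.smooth'.comp (contDiff_fst.smul contDiff_snd)).smul contDiff_snd
end

section
/- Let m ≥ 1 and let k be a natural number. For every smooth function φ : ℝ^m → ℝ and every index j ∈ {1,…,m}, the j-th partial derivative at the origin of the k-th iterated Laplacian of the Euler derivative x ↦ ⟨x, ∇φ(x)⟩ satisfies ∂_j(Δ^k(x ↦ ⟨x, ∇φ(x)⟩))(0) = (2k+1) · ∂_j(Δ^k φ)(0). (This expresses that the distribution ∂^{2k+1} δ(x) is homogeneous of degree −(m+2k+1): E ∂^{2k+1}δ = −(m+2k+1) ∂^{2k+1}δ for the Euler operator E.) -/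
open MeasureTheory Metric Finset
open scoped SchwartzMap

section DirectionalDerivative

variable {E : Type*} [NormedAddCommGroup E] [NormedSpace ℝ E] {f g : E → ℝ}

lemma ContDiff.fderiv_apply_const (hf : ContDiff ℝ (⊤ : ℕ∞) f) (v : E) :
    ContDiff ℝ (⊤ : ℕ∞) (fun x => fderiv ℝ f x v) :=
  (hf.fderiv_right (by simp)).clm_apply contDiff_const

lemma ContDiff.fderiv_apply_self (hf : ContDiff ℝ (⊤ : ℕ∞) f) :
    ContDiff ℝ (⊤ : ℕ∞) (fun x => fderiv ℝ f x x) :=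
  (hf.fderiv_right (by simp)).clm_apply contDiff_id

lemma fderiv_add_const_mul_apply (hf : Differentiable ℝ f) (hg : Differentiable ℝ g)
    (c : ℝ) (x v : E) :
    fderiv ℝ (fun y => f y + c * g y) x v = fderiv ℝ f x v + c * fderiv ℝ g x v := by
  rw [((hf x).hasFDerivAt.fun_add ((hg x).hasFDerivAt.const_mul c)).fderiv]
  simp

/-- A directional derivative of the Euler derivative `x ↦ fderiv ℝ f x x`. -/
lemma fderiv_euler_apply (hf : ContDiff ℝ (⊤ : ℕ∞) f) (x v : E) :
    fderiv ℝ (fun y => fderiv ℝ f y y) x v =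
      fderiv ℝ (fun y => fderiv ℝ f y v) x x + fderiv ℝ f x v := by
  have hd : DifferentiableAt ℝ (fderiv ℝ f) x :=
    (hf.fderiv_right (m := (⊤ : ℕ∞)) (by simp)).differentiable (by simp) x
  have hsymm : IsSymmSndFDerivAt ℝ f x :=
    hf.contDiffAt.isSymmSndFDerivAt (by simpa using WithTop.coe_le_coe.2 (le_top (a := (2 : ℕ∞))))
  have hself : HasFDerivAt (fun y => fderiv ℝ f y y) _ x :=
    hd.hasFDerivAt.clm_apply (hasFDerivAt_id x)
  rw [hself.fderiv,
    (hd.hasFDerivAt.clm_apply (hasFDerivAt_const v x)).fderiv]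
  simp [hsymm.eq v x, add_comm]

/-- A second directional derivative of the Euler derivative `x ↦ fderiv ℝ f x x`. -/
lemma fderiv_fderiv_euler_apply (hf : ContDiff ℝ (⊤ : ℕ∞) f) (x v : E) :
    fderiv ℝ (fun z => fderiv ℝ (fun y => fderiv ℝ f y y) z v) x v =
      fderiv ℝ (fun z => fderiv ℝ (fun y => fderiv ℝ f y v) z v) x x +
        2 * fderiv ℝ (fun y => fderiv ℝ f y v) x v := by
  have hv := hf.fderiv_apply_const v
  have hsum := fderiv_add_const_mul_apply (hv.fderiv_apply_self.differentiable (by simp))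
    (hv.differentiable (by simp)) 1 x v
  simp only [one_mul] at hsum
  simp only [fderiv_euler_apply hf]
  rw [hsum, fderiv_euler_apply hv]
  ring

end DirectionalDerivative

section Laplacian

variable {m : ℕ} {f g : EuclideanSpace ℝ (Fin m) → ℝ}

lemma ContDiff.laplacian_top (hf : ContDiff ℝ (⊤ : ℕ∞) f) :
    ContDiff ℝ (⊤ : ℕ∞) (laplacian f) :=
  ContDiff.sum fun _ _ => (hf.fderiv_apply_const _).fderiv_apply_const _

lemma ContDiff.iterate_laplacian_top (hf : ContDiff ℝ (⊤ : ℕ∞) f) (k : ℕ) :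
    ContDiff ℝ (⊤ : ℕ∞) (laplacian^[k] f) := by
  induction k with
  | zero => exact hf
  | succ k ih =>
    rw [Function.iterate_succ_apply']
    exact ih.laplacian_top

lemma laplacian_add_const_mul (hf : ContDiff ℝ (⊤ : ℕ∞) f) (hg : ContDiff ℝ (⊤ : ℕ∞) g)
    (c : ℝ) :
    laplacian (fun x => f x + c * g x) = fun x => laplacian f x + c * laplacian g x := by
  ext x
  simp only [laplacian, Finset.mul_sum, ← Finset.sum_add_distrib,
    fderiv_add_const_mul_apply (hf.differentiable (by simp)) (hg.differentiable (by simp))]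
  exact Finset.sum_congr rfl fun i _ => fderiv_add_const_mul_apply
    ((hf.fderiv_apply_const _).differentiable (by simp))
    ((hg.fderiv_apply_const _).differentiable (by simp)) c x _

/-- The commutator of the Laplacian with the Euler derivative is twice the Laplacian. -/
lemma laplacian_euler (hf : ContDiff ℝ (⊤ : ℕ∞) f) :
    laplacian (fun x => fderiv ℝ f x x) =
      fun x => fderiv ℝ (laplacian f) x x + 2 * laplacian f x := by
  ext x
  have hsum : fderiv ℝ (laplacian f) x = ∑ i : Fin m,
      fderiv ℝ (fun z => fderiv ℝ (fun y => fderiv ℝ f y (EuclideanSpace.single i 1)) z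
        (EuclideanSpace.single i 1)) x :=
    fderiv_fun_sum fun i _ => ((hf.fderiv_apply_const _).fderiv_apply_const _).differentiable
      (by simp) x
  rw [hsum]
  simp only [laplacian, fderiv_fderiv_euler_apply hf, Finset.sum_add_distrib, Finset.mul_sum,
    _root_.sum_apply]

lemma iterate_laplacian_euler (hf : ContDiff ℝ (⊤ : ℕ∞) f) (k : ℕ) :
    laplacian^[k] (fun x => fderiv ℝ f x x) =
      fun x => fderiv ℝ (laplacian^[k] f) x x + 2 * k * laplacian^[k] f x := by
  induction k with
  | zero => simp
  | succ k ih =>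
    have hk := hf.iterate_laplacian_top k
    rw [Function.iterate_succ_apply', ih, laplacian_add_const_mul hk.fderiv_apply_self hk,
      laplacian_euler hk]
    simp only [Function.iterate_succ_apply']
    ext x
    push_cast
    ring

end Laplacian

/-- E ∂^{2k+1}δ = −(m+2k+1) ∂^{2k+1}δ, componentwise:
∂_j(Δ^k(x ↦ ⟨x, ∇φ(x)⟩))(0) = (2k+1)·∂_j(Δ^k φ)(0). -/
theorem fderiv_iteratedLaplacian_euler (m k : ℕ) (hm : 1 ≤ m)
    (φ : EuclideanSpace ℝ (Fin m) → ℝ) (hφ : ContDiff ℝ (⊤ : ℕ∞) φ) (j : Fin m) :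
    fderiv ℝ (laplacian^[k] (fun x => fderiv ℝ φ x x)) 0 (EuclideanSpace.single j 1) =
      (2 * k + 1 : ℝ) * fderiv ℝ (laplacian^[k] φ) 0 (EuclideanSpace.single j 1) := by
  have hk := hφ.iterate_laplacian_top k
  rw [iterate_laplacian_euler hφ, fderiv_add_const_mul_apply
    (hk.fderiv_apply_self.differentiable (by simp)) (hk.differentiable (by simp)),
    fderiv_euler_apply hk, map_zero]
  ring
end

section
/- Let m ≥ 1 and let k be a natural number. For every smooth function φ : ℝ^m → ℝ and all indices i, j ∈ {1,…,m}, the k-th iterated Laplacian of the function x ↦ x_i · ∂_j φ(x) − x_j · ∂_i φ(x), evaluated at the origin, vanishes: Δ^k(x ↦ x_i ∂_j φ(x) − x_j ∂_i φ(x))(0) = 0. (This expresses that the angular momentum operator Γ annihilates the delta distribution and all iterated Laplacians of it: Γ Δ^k δ(x) = 0, i.e. Δ^k δ is rotation invariant.) -/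
open MeasureTheory Metric Finset
open scoped SchwartzMap

/-- The derivative of `f` in the constant direction `v`. -/
noncomputable def dirDeriv {m : ℕ} (v : EuclideanSpace ℝ (Fin m))
    (f : EuclideanSpace ℝ (Fin m) → ℝ) (x : EuclideanSpace ℝ (Fin m)) : ℝ :=
  fderiv ℝ f x v

theorem ContDiff.dirDeriv {m : ℕ} {f : EuclideanSpace ℝ (Fin m) → ℝ}
    (hf : ContDiff ℝ (⊤ : ℕ∞) f) (v : EuclideanSpace ℝ (Fin m)) :
    ContDiff ℝ (⊤ : ℕ∞) (dirDeriv v f) :=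
  (hf.fderiv_right (m := (⊤ : ℕ∞)) (by simp)).clm_apply contDiff_const

theorem laplacian_eq_sum_dirDeriv {m : ℕ} (f : EuclideanSpace ℝ (Fin m) → ℝ) :
    laplacian f = fun x => ∑ l : Fin m,
      dirDeriv (EuclideanSpace.single l 1) (dirDeriv (EuclideanSpace.single l 1) f) x :=
  rfl

theorem ContDiff.laplacian {m : ℕ} {f : EuclideanSpace ℝ (Fin m) → ℝ}
    (hf : ContDiff ℝ (⊤ : ℕ∞) f) : ContDiff ℝ (⊤ : ℕ∞) (laplacian f) := by
  rw [laplacian_eq_sum_dirDeriv]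
  exact ContDiff.sum fun l _ => (hf.dirDeriv _).dirDeriv _

theorem dirDeriv_comm {m : ℕ} {f : EuclideanSpace ℝ (Fin m) → ℝ}
    (hf : ContDiff ℝ (⊤ : ℕ∞) f) (v w : EuclideanSpace ℝ (Fin m)) :
    dirDeriv v (dirDeriv w f) = dirDeriv w (dirDeriv v f) := by
  have key (u u' x : EuclideanSpace ℝ (Fin m)) :
      dirDeriv u (dirDeriv u' f) x = fderiv ℝ (fderiv ℝ f) x u u' := by
    have hd : DifferentiableAt ℝ (fderiv ℝ f) x :=
      (hf.fderiv_right (m := (⊤ : ℕ∞)) (by simp)).differentiable (by simp) x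
    change fderiv ℝ (fun y => fderiv ℝ f y u') x u = _
    rw [fderiv_clm_apply hd (differentiableAt_const u')]
    simp
  ext x
  rw [key, key]
  exact (hf.contDiffAt.isSymmSndFDerivAt
    (by simpa using WithTop.coe_le_coe.2 (le_top : (2 : ℕ∞) ≤ ⊤))).eq v w

theorem dirDeriv_sub {m : ℕ} {f g : EuclideanSpace ℝ (Fin m) → ℝ}
    (hf : Differentiable ℝ f) (hg : Differentiable ℝ g) (v : EuclideanSpace ℝ (Fin m)) :
    dirDeriv v (fun x => f x - g x) = fun x => dirDeriv v f x - dirDeriv v g x := by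
  ext x
  simp only [dirDeriv]
  rw [fderiv_fun_sub (hf x) (hg x)]
  rfl

theorem dirDeriv_add {m : ℕ} {f g : EuclideanSpace ℝ (Fin m) → ℝ}
    (hf : Differentiable ℝ f) (hg : Differentiable ℝ g) (v : EuclideanSpace ℝ (Fin m)) :
    dirDeriv v (fun x => f x + g x) = fun x => dirDeriv v f x + dirDeriv v g x := by
  ext x
  simp only [dirDeriv]
  rw [fderiv_fun_add (hf x) (hg x)]
  rfl

theorem dirDeriv_const_mul {m : ℕ} {f : EuclideanSpace ℝ (Fin m) → ℝ}
    (hf : Differentiable ℝ f) (c : ℝ) (v : EuclideanSpace ℝ (Fin m)) :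
    dirDeriv v (fun x => c * f x) = fun x => c * dirDeriv v f x := by
  ext x
  simp only [dirDeriv]
  rw [fderiv_const_mul (hf x)]
  rfl

theorem contDiff_coord {m : ℕ} (i : Fin m) :
    ContDiff ℝ (⊤ : ℕ∞) (fun x : EuclideanSpace ℝ (Fin m) => x i) :=
  (EuclideanSpace.proj (𝕜 := ℝ) i).contDiff

theorem dirDeriv_coord_mul {m : ℕ} {f : EuclideanSpace ℝ (Fin m) → ℝ}
    (hf : Differentiable ℝ f) (i : Fin m) (v : EuclideanSpace ℝ (Fin m)) :
    dirDeriv v (fun x => x i * f x) = fun x => v i * f x + x i * dirDeriv v f x := by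
  ext x
  have hc : HasFDerivAt (fun y : EuclideanSpace ℝ (Fin m) => y i)
      (EuclideanSpace.proj (𝕜 := ℝ) i) x := (EuclideanSpace.proj (𝕜 := ℝ) i).hasFDerivAt
  simp only [dirDeriv]
  rw [(hc.fun_mul (hf x).hasFDerivAt).fderiv]
  simp
  ring

theorem laplacian_coord_mul {m : ℕ} {f : EuclideanSpace ℝ (Fin m) → ℝ}
    (hf : ContDiff ℝ (⊤ : ℕ∞) f) (i : Fin m) :
    laplacian (fun x => x i * f x) = fun x =>
      2 * dirDeriv (EuclideanSpace.single i 1) f x + x i * laplacian f x := by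
  have hd : Differentiable ℝ f := hf.differentiable (by simp)
  have hD (v : EuclideanSpace ℝ (Fin m)) : Differentiable ℝ (dirDeriv v f) :=
    (hf.dirDeriv v).differentiable (by simp)
  have second (v x : EuclideanSpace ℝ (Fin m)) :
      dirDeriv v (dirDeriv v (fun x => x i * f x)) x =
        2 * (v i * dirDeriv v f x) + x i * dirDeriv v (dirDeriv v f) x := by
    rw [dirDeriv_coord_mul hd, dirDeriv_add (hd.const_mul _)
      (((contDiff_coord i).differentiable (by simp)).fun_mul (hD v)),
      dirDeriv_const_mul hd, dirDeriv_coord_mul (hD v)]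
    ring
  ext x
  simp only [laplacian_eq_sum_dirDeriv, second, Finset.sum_add_distrib, ← Finset.mul_sum]
  simp [PiLp.single_apply]

theorem laplacian_sub {m : ℕ} {f g : EuclideanSpace ℝ (Fin m) → ℝ}
    (hf : ContDiff ℝ (⊤ : ℕ∞) f) (hg : ContDiff ℝ (⊤ : ℕ∞) g) :
    laplacian (fun x => f x - g x) = fun x => laplacian f x - laplacian g x := by
  ext x
  simp only [laplacian_eq_sum_dirDeriv, ← Finset.sum_sub_distrib]
  refine Finset.sum_congr rfl fun l _ => ?_
  rw [dirDeriv_sub (hf.differentiable (by simp)) (hg.differentiable (by simp)),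
    dirDeriv_sub ((hf.dirDeriv _).differentiable (by simp))
      ((hg.dirDeriv _).differentiable (by simp))]

theorem laplacian_dirDeriv {m : ℕ} {f : EuclideanSpace ℝ (Fin m) → ℝ}
    (hf : ContDiff ℝ (⊤ : ℕ∞) f) (v : EuclideanSpace ℝ (Fin m)) :
    laplacian (dirDeriv v f) = dirDeriv v (laplacian f) := by
  ext x
  have hd (l : Fin m) : DifferentiableAt ℝ (dirDeriv (EuclideanSpace.single l 1)
      (dirDeriv (EuclideanSpace.single l 1) f)) x :=
    ((hf.dirDeriv _).dirDeriv _).differentiable (by simp) x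
  have hsum : dirDeriv v (laplacian f) x = ∑ l : Fin m, dirDeriv v
      (dirDeriv (EuclideanSpace.single l 1) (dirDeriv (EuclideanSpace.single l 1) f)) x := by
    rw [laplacian_eq_sum_dirDeriv, dirDeriv, fderiv_fun_sum fun l _ => hd l]
    simp [dirDeriv]
  rw [hsum, laplacian_eq_sum_dirDeriv]
  refine Finset.sum_congr rfl fun l _ => ?_
  rw [dirDeriv_comm hf _ v, dirDeriv_comm (hf.dirDeriv _) _ v]

/-- The Laplacian commutes with the angular momentum operator `x_i ∂_j - x_j ∂_i`. -/
theorem laplacian_angular_momentum {m : ℕ} {f : EuclideanSpace ℝ (Fin m) → ℝ}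
    (hf : ContDiff ℝ (⊤ : ℕ∞) f) (i j : Fin m) :
    laplacian (fun x => x i * dirDeriv (EuclideanSpace.single j 1) f x -
        x j * dirDeriv (EuclideanSpace.single i 1) f x) =
      fun x => x i * dirDeriv (EuclideanSpace.single j 1) (laplacian f) x -
        x j * dirDeriv (EuclideanSpace.single i 1) (laplacian f) x := by
  rw [laplacian_sub ((contDiff_coord i).mul (hf.dirDeriv _))
      ((contDiff_coord j).mul (hf.dirDeriv _)),
    laplacian_coord_mul (hf.dirDeriv _), laplacian_coord_mul (hf.dirDeriv _),
    laplacian_dirDeriv hf, laplacian_dirDeriv hf,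
    dirDeriv_comm hf (EuclideanSpace.single i 1)]
  ext x
  ring

/-- Γ Δ^k δ(x) = 0: the angular momentum operator annihilates all iterated
Laplacians of the delta distribution. -/
theorem iteratedLaplacian_angular_momentum (m k : ℕ) (hm : 1 ≤ m)
    (φ : EuclideanSpace ℝ (Fin m) → ℝ) (hφ : ContDiff ℝ (⊤ : ℕ∞) φ) (i j : Fin m) :
    laplacian^[k]
        (fun x => x i * fderiv ℝ φ x (EuclideanSpace.single j 1) -
          x j * fderiv ℝ φ x (EuclideanSpace.single i 1)) 0 = 0 := by
  change laplacian^[k] (fun x => x i * dirDeriv (EuclideanSpace.single j 1) φ x -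
    x j * dirDeriv (EuclideanSpace.single i 1) φ x) 0 = 0
  induction k generalizing φ with
  | zero => simp
  | succ k ih =>
    rw [Function.iterate_succ_apply, laplacian_angular_momentum hφ]
    exact ih _ hφ.laplacian
end
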